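/- arXiv:2303.18148 — 2 statements merged into one kernel-verified Lean document; each statement's English description precedes it below -/
import Mathlib

section
/- Let Σ(A,B,C,G) be a C^∞-BIBO stable system node with finite-dimensional input and output spaces, and let h be the matrix-valued measure of bounded total variation with ĥ = G on C_{ω(T)}. Let (u,x,y) be a generalised solution in the distributional sense with x(0) = 0 and u ∈ L^∞_loc([0,∞),U). Then y = h ∗ u, y ∈ L^∞_loc([0,∞),Y), and ‖y‖_{L^∞([0,T],Y)} ≤ ‖h‖_M ‖u‖_{L^∞([0,T],U)} for all T > 0. -/
/-- A bundled complex Banach space (declared before `open MeasureTheory`, whose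
notations interfere with instance-binder fields in structures). -/
structure CplxBanach where
  carrier : Type
  [nacg : NormedAddCommGroup carrier]
  [nsp : NormedSpace ℂ carrier]
  [cs : CompleteSpace carrier]

attribute [instance] CplxBanach.nacg CplxBanach.nsp CplxBanach.cs

/-- A bundled complex Hilbert space. -/
structure CplxHilbert where
  carrier : Type
  [nacg : NormedAddCommGroup carrier]
  [ips : InnerProductSpace ℂ carrier]
  [cs : CompleteSpace carrier]

attribute [instance] CplxHilbert.nacg CplxHilbert.ips CplxHilbert.cs

open MeasureTheory Set
open scoped ENNReal NNReal Topology

noncomputable section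

/-- A strongly continuous semigroup of bounded linear operators on a complex Banach space. -/
structure C0Semigroup (X : Type*) [NormedAddCommGroup X] [NormedSpace ℂ X] where
  T : ℝ → X →L[ℂ] X
  map_zero : T 0 = ContinuousLinearMap.id ℂ X
  map_add : ∀ s t : ℝ, 0 ≤ s → 0 ≤ t → T (s + t) = (T s).comp (T t)
  strongly_continuous : ∀ x : X, ContinuousOn (fun t => T t x) (Set.Ici 0)

namespace C0Semigroup

variable {X : Type*} [NormedAddCommGroup X] [NormedSpace ℂ X]

/-- The growth bound `ω(T)` of a strongly continuous semigroup. -/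
def growthBound (S : C0Semigroup X) : ℝ :=
  sInf {w : ℝ | ∃ M : ℝ, ∀ t : ℝ, 0 ≤ t → ‖S.T t‖ ≤ M * Real.exp (w * t)}

/-- Exponential stability of a strongly continuous semigroup. -/
def ExpStable (S : C0Semigroup X) : Prop :=
  ∃ ε : ℝ, 0 < ε ∧ ∃ M : ℝ, ∀ t : ℝ, 0 ≤ t → ‖S.T t‖ ≤ M * Real.exp (-ε * t)

/-- The semigroup is analytic: it extends analytically to an open sector around the
positive real axis, the extension satisfying the semigroup property on the sector. -/
def IsAnalytic (S : C0Semigroup X) : Prop :=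
  ∃ θ : ℝ, θ ∈ Set.Ioo 0 (Real.pi / 2) ∧ ∃ F : ℂ → X →L[ℂ] X,
    DifferentiableOn ℂ F {z : ℂ | z ≠ 0 ∧ |Complex.arg z| < θ} ∧
    (∀ t : ℝ, 0 < t → F t = S.T t) ∧
    (∀ z w : ℂ, (z ≠ 0 ∧ |Complex.arg z| < θ) → (w ≠ 0 ∧ |Complex.arg w| < θ) →
      F (z + w) = (F z).comp (F w))

/-- The fractional power `(-A)^{-γ}` of the negative generator of an exponentially
stable semigroup, defined through the standard integral formula
`(-A)^{-γ} = Γ(γ)⁻¹ ∫_0^∞ t^{γ-1} T(t) dt` (and the identity for `γ = 0`). -/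
def negAPow (S : C0Semigroup X) (γ : ℝ) : X →L[ℂ] X :=
  if γ = 0 then ContinuousLinearMap.id ℂ X
  else (Real.Gamma γ)⁻¹ • ∫ t in Set.Ioi (0:ℝ), t ^ (γ - 1) • S.T t

end C0Semigroup

/-- A system node `Σ(A,B,C,G)` on the Banach spaces `(U, X, Y)`, in the sense of Staffans.
The extrapolation space `X_{-1}` is given as the space `Xm1` together with a dense
continuous embedding `ι : X → X_{-1}`; `Am1 : X → X_{-1}` is the extension
`A_{-1}` of the generator restricted to `X` (which is bounded from `X` to `X_{-1}`);
the domain of `A` is the set of `x ∈ X` with `A_{-1} x ∈ X`.  `R s` is the resolvent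
`(s - A_{-1})^{-1} : X_{-1} → X`, defined (as specified by `R_right`, `R_left`) for
`Re s > ω(T)`.  `B : U → X_{-1}` is the control operator and `Cop` is the observation
operator `C : X_1 → Y`, encoded as a map on all of `X` that is linear and
`X_1`-bounded on the domain of `A`.  `G` is the transfer function. -/
structure SystemNode (U : Type*) (X : Type*) (Xm1 : Type*) (Y : Type*)
    [NormedAddCommGroup U] [NormedSpace ℂ U]
    [NormedAddCommGroup X] [NormedSpace ℂ X]
    [NormedAddCommGroup Xm1] [NormedSpace ℂ Xm1]
    [NormedAddCommGroup Y] [NormedSpace ℂ Y] where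
  S : C0Semigroup X
  Sm1 : C0Semigroup Xm1
  ι : X →L[ℂ] Xm1
  ι_injective : Function.Injective (fun x : X => ι x)
  ι_dense : DenseRange (fun x : X => ι x)
  semigroup_compat : ∀ t : ℝ, 0 ≤ t → ∀ x : X, Sm1.T t (ι x) = ι (S.T t x)
  Am1 : X →L[ℂ] Xm1
  generator : ∀ x : X, ∀ t : ℝ, 0 ≤ t →
    HasDerivWithinAt (fun τ : ℝ => ι (S.T τ x)) (Am1 (S.T t x)) (Set.Ici 0) t
  B : U →L[ℂ] Xm1
  Cop : X → Y
  Cop_add : ∀ x₁ x₂ : X, (∃ z : X, Am1 x₁ = ι z) → (∃ z : X, Am1 x₂ = ι z) →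
    Cop (x₁ + x₂) = Cop x₁ + Cop x₂
  Cop_smul : ∀ (a : ℂ) (x : X), (∃ z : X, Am1 x = ι z) → Cop (a • x) = a • Cop x
  Cop_bound : ∃ M : ℝ, ∀ x z : X, Am1 x = ι z → ‖Cop x‖ ≤ M * (‖x‖ + ‖z‖)
  R : ℂ → Xm1 →L[ℂ] X
  R_right : ∀ s : ℂ, S.growthBound < s.re → ∀ w : Xm1, s • ι (R s w) - Am1 (R s w) = w
  R_left : ∀ s : ℂ, S.growthBound < s.re → ∀ x : X, R s (s • ι x - Am1 x) = x
  G : ℂ → U →L[ℂ] Y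
  G_analytic : DifferentiableOn ℂ (fun s => G s) {s : ℂ | S.growthBound < s.re}
  G_shift : ∀ α β : ℂ, S.growthBound < α.re → S.growthBound < β.re → ∀ u : U,
    G α u - G β u = Cop (R α (B u) - R β (B u))

namespace SystemNode

variable {U X Xm1 Y : Type*}
  [NormedAddCommGroup U] [NormedSpace ℂ U]
  [NormedAddCommGroup X] [NormedSpace ℂ X]
  [NormedAddCommGroup Xm1] [NormedSpace ℂ Xm1]
  [NormedAddCommGroup Y] [NormedSpace ℂ Y]

/-- The domain of the generator `A`: those `x ∈ X` with `A_{-1} x ∈ X`. -/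
def domA (sys : SystemNode U X Xm1 Y) : Set X := {x : X | ∃ z : X, sys.Am1 x = sys.ι z}

/-- A fixed point in the half-plane of analyticity of the transfer function. -/
def betaPt (sys : SystemNode U X Xm1 Y) : ℂ := ((sys.S.growthBound + 1 : ℝ) : ℂ)

/-- The combined observation/feedthrough operator
`C&D (x,u) = C[x - (β - A)⁻¹ B u] + G(β) u`. -/
def CD (sys : SystemNode U X Xm1 Y) (x : X) (u : U) : Y :=
  sys.Cop (x - sys.R sys.betaPt (sys.B u)) + sys.G sys.betaPt u

/-- The pair `(x,u)` belongs to the domain of the combined operator `C&D`,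
i.e. `A_{-1} x + B u ∈ X`. -/
def memCD (sys : SystemNode U X Xm1 Y) (x : X) (u : U) : Prop :=
  ∃ z : X, sys.Am1 x + sys.B u = sys.ι z

/-- A classical solution `(u,x,y)` of the system node on `[0,∞)`:
`u, y` continuous, `x` continuously differentiable with
`ẋ(t) = A x(t) + B u(t)` (in particular `(x(t),u(t)) ∈ D(C&D)`) and
`y(t) = C&D (x(t),u(t))` for all `t ≥ 0`. -/
def IsClassicalSolution (sys : SystemNode U X Xm1 Y)
    (u : ℝ → U) (x : ℝ → X) (y : ℝ → Y) : Prop :=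
  ContinuousOn u (Set.Ici 0) ∧ ContinuousOn y (Set.Ici 0) ∧
  (∃ x' : ℝ → X, ContinuousOn x' (Set.Ici 0) ∧
    (∀ t ∈ Set.Ici (0:ℝ), HasDerivWithinAt x (x' t) (Set.Ici 0) t) ∧
    (∀ t ∈ Set.Ici (0:ℝ), sys.Am1 (x t) + sys.B (u t) = sys.ι (x' t))) ∧
  (∀ t ∈ Set.Ici (0:ℝ), y t = sys.CD (x t) (u t))

/-- `C^∞`-BIBO stability: there is `c > 0` such that every classical solution with
zero initial state and smooth input compactly supported in `(0,∞)` has output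
bounded by `c` times the sup-norm of the input. -/
def CInfBIBOStable (sys : SystemNode U X Xm1 Y) : Prop :=
  ∃ c : ℝ, 0 < c ∧ ∀ (u : ℝ → U) (x : ℝ → X) (y : ℝ → Y),
    sys.IsClassicalSolution u x y → x 0 = 0 →
    ContDiff ℝ (⊤ : ℕ∞) u → HasCompactSupport u → tsupport u ⊆ Set.Ioi 0 →
    ∀ M : ℝ, (∀ s : ℝ, ‖u s‖ ≤ M) → ∀ t : ℝ, 0 ≤ t → ‖y t‖ ≤ c * M

/-- The state part of a generalised solution in the distributional sense:
`u ∈ L¹_loc`, `x` continuous `X_{-1}`-valued, given by the variation of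
constants formula with initial state `x₀ ∈ X`. -/
def IsMildState (sys : SystemNode U X Xm1 Y) (x₀ : X) (u : ℝ → U) (xs : ℝ → Xm1) : Prop :=
  MeasureTheory.LocallyIntegrableOn u (Set.Ici 0) ∧
  ContinuousOn xs (Set.Ici 0) ∧
  ∀ t : ℝ, 0 ≤ t →
    IntervalIntegrable (fun s => sys.Sm1.T (t - s) (sys.B (u s))) MeasureTheory.volume 0 t ∧
    xs t = sys.Sm1.T t (sys.ι x₀) + ∫ s in (0:ℝ)..t, sys.Sm1.T (t - s) (sys.B (u s))

/-- The output part of a generalised solution in the distributional sense: the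
(locally integrable representative of the) `Y`-valued distribution
`y = d²/dt² ( C&D ∫_0^t (t-s) (x(s), u(s)) ds )`. -/
def IsGenOutput (sys : SystemNode U X Xm1 Y) (u : ℝ → U) (xs : ℝ → Xm1) (y : ℝ → Y) : Prop :=
  MeasureTheory.LocallyIntegrableOn y (Set.Ici 0) ∧
  ∃ (K : ℝ → X) (L : ℝ → U),
    (∀ t : ℝ, 0 ≤ t → sys.ι (K t) = ∫ s in (0:ℝ)..t, (t - s) • xs s) ∧
    (∀ t : ℝ, 0 ≤ t → L t = ∫ s in (0:ℝ)..t, (t - s) • u s) ∧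
    (∀ t : ℝ, 0 ≤ t → sys.memCD (K t) (L t)) ∧
    (∀ φ : ℝ → ℝ, ContDiff ℝ (⊤ : ℕ∞) φ → HasCompactSupport φ → tsupport φ ⊆ Set.Ioi 0 →
      ∫ t in Set.Ioi (0:ℝ), deriv (deriv φ) t • sys.CD (K t) (L t) =
        ∫ t in Set.Ioi (0:ℝ), φ t • y t)

/-- A generalised solution in the distributional sense. -/
def IsGeneralizedSolution (sys : SystemNode U X Xm1 Y) (x₀ : X)
    (u : ℝ → U) (xs : ℝ → Xm1) (y : ℝ → Y) : Prop :=
  sys.IsMildState x₀ u xs ∧ sys.IsGenOutput u xs y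

/-- `L^∞`-BIBO stability: there is `c > 0` such that for every generalised solution in
the distributional sense with zero initial state and locally essentially bounded input,
the output is represented by a locally essentially bounded function with
`‖y‖_{L^∞([0,t])} ≤ c ‖u‖_{L^∞([0,t])}` for all `t > 0`. -/
def LInfBIBOStable (sys : SystemNode U X Xm1 Y) : Prop :=
  ∃ c : ℝ, 0 < c ∧ ∀ (u : ℝ → U) (xs : ℝ → Xm1),
    sys.IsMildState 0 u xs →
    (∀ t : ℝ, 0 < t → ∃ M : ℝ,
      ∀ᵐ s ∂(MeasureTheory.volume.restrict (Set.Ioc (0:ℝ) t)), ‖u s‖ ≤ M) →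
    ∃ y : ℝ → Y, sys.IsGenOutput u xs y ∧
      ∀ t : ℝ, 0 < t → ∀ M : ℝ,
        (∀ᵐ s ∂(MeasureTheory.volume.restrict (Set.Ioc (0:ℝ) t)), ‖u s‖ ≤ M) →
        (∀ᵐ s ∂(MeasureTheory.volume.restrict (Set.Ioc (0:ℝ) t)), ‖y s‖ ≤ c * M)

/-- `L^p`-control-admissibility of the control operator `B`. -/
def ControlAdmissible (sys : SystemNode U X Xm1 Y) (p : ℝ≥0∞) : Prop :=
  ∀ t : ℝ, 0 < t → ∃ M : ℝ, ∀ u : ℝ → U,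
    IntervalIntegrable (fun s => sys.Sm1.T (t - s) (sys.B (u s))) MeasureTheory.volume 0 t →
    ∃ x : X, sys.ι x = ∫ s in (0:ℝ)..t, sys.Sm1.T (t - s) (sys.B (u s)) ∧
      ‖x‖ ≤ M * (eLpNorm u p (MeasureTheory.volume.restrict (Set.Ioc (0:ℝ) t))).toReal

/-- Infinite-time `L^p`-control-admissibility: the admissibility constant can be chosen
uniformly in `t`. -/
def InfTimeControlAdmissible (sys : SystemNode U X Xm1 Y) (p : ℝ≥0∞) : Prop :=
  ∃ M : ℝ, ∀ t : ℝ, 0 < t → ∀ u : ℝ → U,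
    IntervalIntegrable (fun s => sys.Sm1.T (t - s) (sys.B (u s))) MeasureTheory.volume 0 t →
    ∃ x : X, sys.ι x = ∫ s in (0:ℝ)..t, sys.Sm1.T (t - s) (sys.B (u s)) ∧
      ‖x‖ ≤ M * (eLpNorm u p (MeasureTheory.volume.restrict (Set.Ioc (0:ℝ) t))).toReal

/-- `L^p`-observation-admissibility of the observation operator `C`. -/
def ObservationAdmissible (sys : SystemNode U X Xm1 Y) (p : ℝ≥0∞) : Prop :=
  ∃ t : ℝ, 0 < t ∧ ∃ M : ℝ, ∀ x z : X, sys.Am1 x = sys.ι z →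
    (eLpNorm (fun s : ℝ => sys.Cop (sys.S.T s x)) p
      (MeasureTheory.volume.restrict (Set.Ioc (0:ℝ) t))).toReal ≤ M * ‖x‖

/-- `L²`-well-posedness of a system node: `B` and `C` are `L²`-admissible and the
transfer function is bounded on some right half-plane. -/
def L2WellPosed (sys : SystemNode U X Xm1 Y) : Prop :=
  sys.ControlAdmissible 2 ∧ sys.ObservationAdmissible 2 ∧
  ∃ w : ℝ, sys.S.growthBound ≤ w ∧ ∃ M : ℝ, ∀ s : ℂ, w < s.re → ‖sys.G s‖ ≤ M

end SystemNode

/-- A (matrix/operator valued) Borel measure of bounded total variation on `[0,∞)`,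
encoded through its polar decomposition: a finite positive measure `μ` supported on
`[0,∞)` together with a density `g` of norm one. -/
structure BVMeasure (U Y : Type*) [NormedAddCommGroup U] [NormedSpace ℂ U]
    [NormedAddCommGroup Y] [NormedSpace ℂ Y] where
  μ : MeasureTheory.Measure ℝ
  finite : MeasureTheory.IsFiniteMeasure μ
  supported : μ (Set.Iio 0) = 0
  g : ℝ → U →L[ℂ] Y
  g_meas : MeasureTheory.AEStronglyMeasurable g μ
  g_norm : ∀ᵐ t ∂μ, ‖g t‖ = 1

namespace BVMeasure

variable {U Y : Type*} [NormedAddCommGroup U] [NormedSpace ℂ U]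
  [NormedAddCommGroup Y] [NormedSpace ℂ Y]

/-- The total variation `‖h‖_M` of the measure. -/
def var (h : BVMeasure U Y) : ℝ := (h.μ Set.univ).toReal

/-- The Laplace transform `ĥ(s) u = ∫ e^{-st} dh(t) u`. -/
def laplace (h : BVMeasure U Y) (s : ℂ) (u : U) : Y :=
  ∫ t, Complex.exp (-(s * t)) • (h.g t u) ∂h.μ

/-- The convolution `(h ∗ u)(t) = ∫_{[0,t]} dh(s) u(t - s)`. -/
def conv (h : BVMeasure U Y) (u : ℝ → U) (t : ℝ) : Y :=
  ∫ s in Set.Icc 0 t, (h.g s) (u (t - s)) ∂h.μ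

end BVMeasure

/-- The Laplace transform of `h` coincides with the transfer function of the node on
the half-plane `ℂ_{ω(T)}` (on `ℂ_{ω(T)} ∩ ℂ_0`, identifying `ĥ` with its analytic
continuation). -/
def LaplaceMatches {U X Xm1 Y : Type*}
    [NormedAddCommGroup U] [NormedSpace ℂ U]
    [NormedAddCommGroup X] [NormedSpace ℂ X]
    [NormedAddCommGroup Xm1] [NormedSpace ℂ Xm1]
    [NormedAddCommGroup Y] [NormedSpace ℂ Y]
    (sys : SystemNode U X Xm1 Y) (h : BVMeasure U Y) : Prop :=
  ∀ s : ℂ, sys.S.growthBound < s.re → 0 ≤ s.re → ∀ u : U, h.laplace s u = sys.G s u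

/-- `sys'` is a system node for the multiplicatively perturbed triple `(AP, B, C)`. -/
def IsMultPerturbed {U X Xm1 Y : Type*}
    [NormedAddCommGroup U] [NormedSpace ℂ U]
    [NormedAddCommGroup X] [NormedSpace ℂ X]
    [NormedAddCommGroup Xm1] [NormedSpace ℂ Xm1]
    [NormedAddCommGroup Y] [NormedSpace ℂ Y]
    (sys sys' : SystemNode U X Xm1 Y) (P : X →L[ℂ] X) : Prop :=
  sys'.ι = sys.ι ∧ sys'.Am1 = sys.Am1.comp P ∧ sys'.B = sys.B ∧ sys'.Cop = sys.Cop

/-- `sys'` is a system node for the additively perturbed triple `(A + P, B, C)`. -/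
def IsAddPerturbed {U X Xm1 Y : Type*}
    [NormedAddCommGroup U] [NormedSpace ℂ U]
    [NormedAddCommGroup X] [NormedSpace ℂ X]
    [NormedAddCommGroup Xm1] [NormedSpace ℂ Xm1]
    [NormedAddCommGroup Y] [NormedSpace ℂ Y]
    (sys sys' : SystemNode U X Xm1 Y) (P : X →L[ℂ] X) : Prop :=
  sys'.ι = sys.ι ∧ sys'.Am1 = sys.Am1 + sys.ι.comp P ∧ sys'.B = sys.B ∧ sys'.Cop = sys.Cop

end

section AuxConv

open Filter

lemma aux_prod_integrable {E1 E2 : Type*} [NormedAddCommGroup E1] [NormedSpace ℂ E1]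
    [NormedAddCommGroup E2] [NormedSpace ℂ E2]
    (μ : Measure ℝ) [IsFiniteMeasure μ] (g : ℝ → E1 →L[ℂ] E2) (hg : Integrable g μ)
    (u : ℝ → E1) (hu : Integrable u) :
    Integrable (fun z : ℝ × ℝ => g z.1 (u z.2)) (μ.prod volume) := by
  refine Integrable.op_fst_snd (op := fun (a : E1 →L[ℂ] E2) (b : E1) => a b) ?_ ?_ hg hu
  · exact (isBoundedBilinearMap_apply (𝕜 := ℂ) (E := E1) (F := E2)).continuous
  · exact ⟨1, fun x y => by simpa using x.le_opNorm y⟩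

lemma aux_conv_integrable {E1 E2 : Type*} [NormedAddCommGroup E1] [NormedSpace ℂ E1]
    [NormedAddCommGroup E2] [NormedSpace ℂ E2]
    (μ : Measure ℝ) [IsFiniteMeasure μ] (g : ℝ → E1 →L[ℂ] E2) (hg : Integrable g μ)
    (u : ℝ → E1) (hu : Integrable u) :
    Integrable (fun σ => ∫ r, g r (u (σ - r)) ∂μ) := by
  have h1 := aux_prod_integrable μ g hg u hu
  have h2 := (measurePreserving_prod_neg_add μ (volume : Measure ℝ)).integrable_comp_of_integrable h1
  have h3 := h2.integral_prod_right
  simpa [Function.comp_def, neg_add_eq_sub] using h3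

lemma aux_conv_fubini {E1 E2 : Type*} [NormedAddCommGroup E1] [NormedSpace ℂ E1]
    [NormedAddCommGroup E2] [NormedSpace ℂ E2]
    (μ : Measure ℝ) [IsFiniteMeasure μ] (g : ℝ → E1 →L[ℂ] E2) (hg : Integrable g μ)
    (u : ℝ → E1) (hu : Integrable u) (k : ℝ → ℝ) (hk : Measurable k) (C : ℝ)
    (hC : ∀ x, |k x| ≤ C) :
    ∫ σ, k σ • ∫ r, g r (u (σ - r)) ∂μ = ∫ s, (∫ r, k (s + r) • g r ∂μ) (u s) := by
  have h1 := aux_prod_integrable μ g hg u hu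
  have h1' : Integrable (fun z : ℝ × ℝ => k (z.1 + z.2) • g z.1 (u z.2)) (μ.prod volume) :=
    Integrable.bdd_smul (𝕜 := ℝ) (φ := fun z : ℝ × ℝ => k (z.1 + z.2)) h1 C (hk.comp (measurable_fst.add measurable_snd)).aestronglyMeasurable
      (Eventually.of_forall fun z => hC (z.1 + z.2))
  have h2 := (measurePreserving_prod_neg_add μ (volume : Measure ℝ)).integrable_comp_of_integrable h1'
  have h2' : Integrable (Function.uncurry fun r σ : ℝ => k σ • g r (u (σ - r)))
      (μ.prod volume) := by
    simpa [Function.comp_def, neg_add_eq_sub, Function.uncurry_def] using h2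
  have h1'' : Integrable (Function.uncurry fun r s : ℝ => k (r + s) • g r (u s))
      (μ.prod volume) := h1'
  calc ∫ σ, k σ • ∫ r, g r (u (σ - r)) ∂μ
      = ∫ σ, ∫ r, k σ • g r (u (σ - r)) ∂μ := by
        simp_rw [integral_smul]
    _ = ∫ r, ∫ σ, k σ • g r (u (σ - r)) ∂volume ∂μ := (integral_integral_swap h2').symm
    _ = ∫ r, ∫ s, k (r + s) • g r (u s) ∂volume ∂μ := by
        congr 1; ext r
        rw [← integral_add_left_eq_self _ r]
        simp
    _ = ∫ s, ∫ r, k (r + s) • g r (u s) ∂μ := integral_integral_swap h1''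
    _ = _ := by
        congr 1; ext s
        rw [ContinuousLinearMap.integral_apply]
        · simp [add_comm]
        · exact Integrable.bdd_smul (𝕜 := ℝ) (φ := fun r : ℝ => k (s + r)) hg C (hk.comp (measurable_const.add measurable_id)).aestronglyMeasurable
            (Eventually.of_forall fun r => hC (s + r))

lemma aux_conv_indicator {E1 E2 : Type*} [NormedAddCommGroup E1] [NormedSpace ℂ E1]
    [NormedAddCommGroup E2] [NormedSpace ℂ E2]
    (μ : Measure ℝ) (hμ : μ (Iio 0) = 0) (g : ℝ → E1 →L[ℂ] E2) (u : ℝ → E1) (t σ : ℝ)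
    (hσt : σ ≤ t) :
    ∫ r in Icc 0 σ, g r (u (σ - r)) ∂μ = ∫ r, g r ((Icc 0 t).indicator u (σ - r)) ∂μ := by
  rw [← integral_indicator measurableSet_Icc]
  apply integral_congr_ae
  have : ∀ᵐ r ∂μ, r ∉ Iio (0:ℝ) := measure_eq_zero_iff_ae_notMem.1 hμ
  filter_upwards [this] with r hr
  simp only [mem_Iio, not_lt] at hr
  by_cases hrσ : r ≤ σ
  · rw [indicator_of_mem (show r ∈ Icc 0 σ from ⟨hr, hrσ⟩), indicator_of_mem]
    constructor <;> linarith
  · rw [indicator_of_notMem (fun h => hrσ h.2), indicator_of_notMem, _root_.map_zero]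
    intro h; exact hrσ (by linarith [h.1])

lemma aux_conv_interval {E1 E2 : Type*} [NormedAddCommGroup E1] [NormedSpace ℂ E1]
    [NormedAddCommGroup E2] [NormedSpace ℂ E2]
    (μ : Measure ℝ) [IsFiniteMeasure μ] (hμ : μ (Iio 0) = 0)
    (g : ℝ → E1 →L[ℂ] E2) (hg : Integrable g μ)
    (u : ℝ → E1) (t : ℝ) (ht : 0 ≤ t) (hu : IntegrableOn u (Icc 0 t)) :
    ∫ σ in (0:ℝ)..t, (t - σ) • ∫ r in Icc 0 σ, g r (u (σ - r)) ∂μ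
      = ∫ s in (0:ℝ)..t, (∫ r, max (t - s - r) 0 • g r ∂μ) (u s) := by
  have hu' : Integrable ((Icc 0 t).indicator u) := (integrable_indicator_iff measurableSet_Icc).2 hu
  have key := aux_conv_fubini μ g hg _ hu' ((Icc 0 t).indicator fun σ => t - σ)
    ((measurable_const.sub measurable_id).indicator measurableSet_Icc) t (by
      intro x
      by_cases hx : x ∈ Icc 0 t
      · rw [indicator_of_mem hx, abs_of_nonneg (by linarith [hx.2])]; linarith [hx.1]
      · rw [indicator_of_notMem hx]; simpa using ht)
  rw [intervalIntegral.integral_of_le ht, intervalIntegral.integral_of_le ht,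
    ← integral_Icc_eq_integral_Ioc, ← integral_Icc_eq_integral_Ioc,
    ← integral_indicator measurableSet_Icc, ← integral_indicator measurableSet_Icc]
  convert key using 1
  · congr 1; ext σ
    by_cases hσ : σ ∈ Icc 0 t
    · rw [indicator_of_mem hσ, indicator_of_mem hσ, aux_conv_indicator μ hμ g u t σ hσ.2]
    · rw [indicator_of_notMem hσ, indicator_of_notMem hσ, zero_smul]
  · congr 1; ext s
    by_cases hs : s ∈ Icc 0 t
    · rw [indicator_of_mem hs, indicator_of_mem hs]
      congr 1
      apply integral_congr_ae
      have : ∀ᵐ r ∂μ, r ∉ Iio (0:ℝ) := measure_eq_zero_iff_ae_notMem.1 hμ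
      filter_upwards [this] with r hr
      simp only [mem_Iio, not_lt] at hr
      congr 1
      by_cases h : s + r ≤ t
      · rw [indicator_of_mem (show s + r ∈ Icc 0 t from ⟨by linarith [hs.1], h⟩), max_eq_left (by linarith)]; ring
      · rw [indicator_of_notMem (fun h' => h h'.2), max_eq_right (by linarith)]
    · rw [indicator_of_notMem hs, indicator_of_notMem hs, _root_.map_zero]

lemma aux_conv_integrableOn {E1 E2 : Type*} [NormedAddCommGroup E1] [NormedSpace ℂ E1]
    [NormedAddCommGroup E2] [NormedSpace ℂ E2]
    (μ : Measure ℝ) [IsFiniteMeasure μ] (hμ : μ (Iio 0) = 0)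
    (g : ℝ → E1 →L[ℂ] E2) (hg : Integrable g μ)
    (u : ℝ → E1) (t : ℝ) (hu : IntegrableOn u (Icc 0 t)) :
    IntegrableOn (fun σ => ∫ r in Icc 0 σ, g r (u (σ - r)) ∂μ) (Icc 0 t) := by
  have hu' : Integrable ((Icc 0 t).indicator u) := (integrable_indicator_iff measurableSet_Icc).2 hu
  refine ((aux_conv_integrable μ g hg _ hu').integrableOn (s := Icc 0 t)).congr_fun ?_
    measurableSet_Icc
  intro σ hσ
  exact (aux_conv_indicator μ hμ g u t σ hσ.2).symm

/-- Second distributional derivative of the double primitive. -/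
lemma aux_test {E : Type*} [NormedAddCommGroup E] [NormedSpace ℂ E] [CompleteSpace E]
    (v : ℝ → E) (hv : ∀ t, IntegrableOn v (Icc 0 t)) (φ : ℝ → ℝ) (hφ : ContDiff ℝ (⊤ : ℕ∞) φ)
    (hc : HasCompactSupport φ) (hs : tsupport φ ⊆ Ioi 0) :
    ∫ t in Ioi (0:ℝ), deriv (deriv φ) t • ∫ σ in (0:ℝ)..t, (t - σ) • v σ
      = ∫ t in Ioi (0:ℝ), φ t • v t := by
  have hφ1 : ContDiff ℝ (⊤ : ℕ∞) (deriv φ) := ((contDiff_infty_iff_deriv).1 hφ).2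
  have hφ2 : ContDiff ℝ (⊤ : ℕ∞) (deriv (deriv φ)) := ((contDiff_infty_iff_deriv).1 hφ1).2
  obtain ⟨T0, hT0⟩ := hc.isCompact.isBounded.subset_closedBall 0
  set T := max T0 0 + 1 with hT
  have hTpos : 0 < T := by have := le_max_right T0 0; linarith
  have hout : ∀ x, T ≤ x → x ∉ tsupport φ := by
    intro x hx hmem
    have := hT0 hmem
    rw [mem_closedBall_zero_iff, Real.norm_eq_abs] at this
    have := le_abs_self x
    have := le_max_left T0 0
    linarith
  have hsub1 : tsupport (deriv φ) ⊆ tsupport φ := tsupport_deriv_subset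
  have hsub2 : tsupport (deriv (deriv φ)) ⊆ tsupport φ := tsupport_deriv_subset.trans hsub1
  have z0 : ∀ x, x ∉ tsupport φ → φ x = 0 := fun x hx => image_eq_zero_of_notMem_tsupport hx
  have z1 : ∀ x, x ∉ tsupport φ → deriv φ x = 0 :=
    fun x hx => image_eq_zero_of_notMem_tsupport fun h => hx (hsub1 h)
  have z2 : ∀ x, x ∉ tsupport φ → deriv (deriv φ) x = 0 :=
    fun x hx => image_eq_zero_of_notMem_tsupport fun h => hx (hsub2 h)
  have hc2 : HasCompactSupport (deriv (deriv φ)) := hc.deriv.deriv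
  obtain ⟨C, hC⟩ := hc2.exists_bound_of_continuous hφ2.continuous
  have hv' : Integrable ((Icc 0 T).indicator v) :=
    (integrable_indicator_iff measurableSet_Icc).2 (hv T)
  let g : ℝ → E →L[ℂ] E := fun r => r • ContinuousLinearMap.id ℂ E
  have hgc : Continuous g := by fun_prop
  have hg : Integrable g (volume.restrict (Icc 0 T)) := hgc.continuousOn.integrableOn_Icc
  have hμ : (volume.restrict (Icc 0 T)) (Iio (0:ℝ)) = 0 := by
    rw [Measure.restrict_apply measurableSet_Iio]
    have : Iio (0:ℝ) ∩ Icc 0 T = ∅ := by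
      ext x; simp only [mem_inter_iff, mem_Iio, mem_Icc, mem_empty_iff_false, iff_false]
      intro h; linarith [h.1, h.2.1]
    rw [this, measure_empty]
  have key := aux_conv_fubini (volume.restrict (Icc 0 T)) g hg _ hv' (deriv (deriv φ))
    hφ2.continuous.measurable C hC
  rw [← integral_indicator measurableSet_Ioi, ← integral_indicator measurableSet_Ioi]
  convert key using 1
  · congr 1; ext t
    by_cases htm : t ∈ tsupport φ
    · have ht0 : 0 < t := hs htm
      have htT : t < T := by
        by_contra h
        exact hout t (not_lt.1 h) htm
      rw [indicator_of_mem (mem_Ioi.2 ht0), ← aux_conv_indicator _ hμ g v T t htT.le,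
        Measure.restrict_restrict measurableSet_Icc,
        inter_eq_left.2 (Icc_subset_Icc_right htT.le), integral_Icc_eq_integral_Ioc,
        ← intervalIntegral.integral_of_le ht0.le]
      congr 1
      have := intervalIntegral.integral_comp_sub_left (a := 0) (b := t)
        (fun σ => (t - σ) • v σ) t
      simp only [sub_self, sub_zero, sub_sub_cancel] at this
      rw [← this]
      rfl
    · rw [z2 t htm]
      by_cases h : t ∈ Ioi (0:ℝ)
      · rw [indicator_of_mem h, z2 t htm, zero_smul, zero_smul]
      · rw [indicator_of_notMem h, zero_smul]
  · congr 1; ext s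
    by_cases hsT : s ∈ Icc 0 T
    · have e1 : (∫ r in Icc 0 T, deriv (deriv φ) (s + r) • g r)
          = φ s • ContinuousLinearMap.id ℂ E := by
        simp only [g, smul_smul]
        rw [integral_smul_const, integral_Icc_eq_integral_Ioc,
          ← intervalIntegral.integral_of_le hTpos.le]
        congr 1
        have hd : ∀ r ∈ uIcc 0 T, HasDerivAt (fun r => deriv φ (s + r) * r - φ (s + r))
            (deriv (deriv φ) (s + r) * r) r := by
          intro r _
          have a1 : HasDerivAt (fun r => deriv φ (s + r)) (deriv (deriv φ) (s + r)) r :=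
            HasDerivAt.comp_const_add s r ((hφ1.differentiable (by simp)) _).hasDerivAt
          have a2 : HasDerivAt (fun r => φ (s + r)) (deriv φ (s + r)) r :=
            HasDerivAt.comp_const_add s r ((hφ.differentiable (by simp)) _).hasDerivAt
          have := (a1.mul (hasDerivAt_id r)).sub a2
          exact this.congr_deriv (by simp)
        have hcont := hφ2.continuous
        rw [intervalIntegral.integral_eq_sub_of_hasDerivAt hd
          (Continuous.intervalIntegrable (by fun_prop) _ _)]
        have : s + T ∉ tsupport φ := hout _ (by linarith [hsT.1])
        rw [z0 _ this, z1 _ this]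
        simp
      rw [e1, indicator_of_mem hsT]
      by_cases h0 : s ∈ Ioi (0:ℝ)
      · rw [indicator_of_mem h0]; simp
      · rw [indicator_of_notMem h0, z0 s (fun h => h0 (hs h))]; simp
    · rw [indicator_of_notMem hsT, _root_.map_zero]
      by_cases h0 : s ∈ Ioi (0:ℝ)
      · rw [indicator_of_mem h0, z0 s, zero_smul]
        refine hout s ?_
        by_contra h
        exact hsT ⟨le_of_lt h0, (not_le.1 h).le⟩
      · rw [indicator_of_notMem h0]

end AuxConv
section AuxLap

open Filter

set_option linter.unusedSectionVars false

variable {E : Type*} [NormedAddCommGroup E] [NormedSpace ℂ E]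

/-- Continuous and exponentially bounded functions. -/
def ExpB (w : ℝ) (f : ℝ → E) : Prop :=
  Continuous f ∧ ∃ M : ℝ, 0 ≤ M ∧ ∀ t : ℝ, 0 ≤ t → ‖f t‖ ≤ M * Real.exp (w * t)

/-- The Laplace transform of a function. -/
noncomputable def lapT (s : ℂ) (f : ℝ → E) : E :=
  ∫ t in Ioi (0:ℝ), Complex.exp (-(s * t)) • f t

lemma norm_cexp_aux (s : ℂ) (t : ℝ) : ‖Complex.exp (-(s * t))‖ = Real.exp (-(s.re * t)) := by
  rw [Complex.norm_exp]; simp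

lemma ExpB.bound {w : ℝ} {f : ℝ → E} (hf : ExpB w f) (s : ℂ) :
    ∃ M : ℝ, ∀ t : ℝ, 0 ≤ t →
      ‖Complex.exp (-(s * t)) • f t‖ ≤ M * Real.exp (-(s.re - w) * t) := by
  obtain ⟨_, M, _, hM⟩ := hf
  refine ⟨M, fun t ht => ?_⟩
  rw [norm_smul, norm_cexp_aux]
  calc _ ≤ Real.exp (-(s.re * t)) * (M * Real.exp (w * t)) := by gcongr; exact hM t ht
    _ = M * (Real.exp (-(s.re * t)) * Real.exp (w * t)) := by ring
    _ = _ := by rw [← Real.exp_add]; ring_nf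

lemma ExpB.integrable {w : ℝ} {f : ℝ → E} (hf : ExpB w f) {s : ℂ} (hs : w < s.re) :
    IntegrableOn (fun t : ℝ => Complex.exp (-(s * t)) • f t) (Ioi 0) := by
  obtain ⟨M, hM⟩ := hf.bound s
  have h1 : IntegrableOn (fun t : ℝ => M * Real.exp (-(s.re - w) * t)) (Ioi 0) :=
    (exp_neg_integrableOn_Ioi 0 (sub_pos.2 hs)).const_mul M
  have hc := hf.1
  refine Integrable.mono' h1 (Continuous.aestronglyMeasurable (by fun_prop)) ?_
  filter_upwards [ae_restrict_mem measurableSet_Ioi] with t ht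
  exact hM t (le_of_lt ht)

lemma ExpB.tendsto {w : ℝ} {f : ℝ → E} (hf : ExpB w f) {s : ℂ} (hs : w < s.re) :
    Tendsto (fun t : ℝ => Complex.exp (-(s * t)) • f t) atTop (𝓝 0) := by
  obtain ⟨M, hM⟩ := hf.bound s
  have h0 : Tendsto (fun t : ℝ => -(s.re - w) * t) atTop atBot :=
    tendsto_id.const_mul_atTop_of_neg (by linarith)
  have h1 : Tendsto (fun t : ℝ => M * Real.exp (-(s.re - w) * t)) atTop (𝓝 0) := by
    simpa using (Real.tendsto_exp_atBot.comp h0).const_mul M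
  refine squeeze_zero_norm' ?_ h1
  filter_upwards [eventually_ge_atTop 0] with t ht using hM t ht

lemma ExpB.add {w : ℝ} {f g : ℝ → E} (hf : ExpB w f) (hg : ExpB w g) :
    ExpB w (fun t => f t + g t) := by
  obtain ⟨h1, M, hM0, hM⟩ := hf
  obtain ⟨h2, N, hN0, hN⟩ := hg
  refine ⟨h1.add h2, M + N, by positivity, fun t ht => ?_⟩
  calc _ ≤ ‖f t‖ + ‖g t‖ := norm_add_le _ _
    _ ≤ _ := by rw [add_mul]; exact add_le_add (hM t ht) (hN t ht)

lemma ExpB.smul {w : ℝ} {f : ℝ → E} (hf : ExpB w f) (c : ℂ) :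
    ExpB w (fun t => c • f t) := by
  obtain ⟨h1, M, hM0, hM⟩ := hf
  refine ⟨by fun_prop, ‖c‖ * M, by positivity, fun t ht => ?_⟩
  rw [norm_smul, mul_assoc]
  gcongr
  exact hM t ht

lemma ExpB.clm {F : Type*} [NormedAddCommGroup F] [NormedSpace ℂ F] {w : ℝ} {f : ℝ → E}
    (hf : ExpB w f) (L : E →L[ℂ] F) : ExpB w (fun t => L (f t)) := by
  obtain ⟨h1, M, hM0, hM⟩ := hf
  refine ⟨by fun_prop, ‖L‖ * M, by positivity, fun t ht => ?_⟩
  rw [mul_assoc]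
  refine (L.le_opNorm _).trans ?_
  gcongr
  exact hM t ht

lemma ExpB.const {w : ℝ} (hw : 0 < w) (c : E) : ExpB w (fun _ => c) := by
  refine ⟨continuous_const, ‖c‖, norm_nonneg _, fun t ht => ?_⟩
  have : 1 ≤ Real.exp (w * t) := Real.one_le_exp (by positivity)
  nlinarith [norm_nonneg c]

lemma lapT_add {w : ℝ} {f g : ℝ → E} (hf : ExpB w f) (hg : ExpB w g) {s : ℂ} (hs : w < s.re) :
    lapT s (fun t => f t + g t) = lapT s f + lapT s g := by
  unfold lapT
  simp_rw [smul_add]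
  exact integral_add (hf.integrable hs) (hg.integrable hs)

lemma lapT_smul (f : ℝ → E) (c : ℂ) (s : ℂ) :
    lapT s (fun t => c • f t) = c • lapT s f := by
  unfold lapT
  rw [← integral_smul]
  congr 1; ext t; rw [smul_comm]

lemma lapT_clm {F : Type*} [NormedAddCommGroup F] [NormedSpace ℂ F] [CompleteSpace F]
    [CompleteSpace E] {w : ℝ} {f : ℝ → E}
    (hf : ExpB w f) (L : E →L[ℂ] F) {s : ℂ} (hs : w < s.re) :
    lapT s (fun t => L (f t)) = L (lapT s f) := by
  unfold lapT
  rw [← ContinuousLinearMap.integral_comp_comm L (hf.integrable hs)]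
  simp

lemma ExpB.prim {w : ℝ} (hw : 0 < w) {f : ℝ → E} (hf : ExpB w f) :
    ExpB w (fun t => ∫ r in (0:ℝ)..t, f r) := by
  obtain ⟨h1, M, hM0, hM⟩ := hf
  refine ⟨intervalIntegral.continuous_primitive (fun a b => h1.intervalIntegrable a b) 0,
    M / w, by positivity, fun t ht => ?_⟩
  have hb : ‖∫ r in (0:ℝ)..t, f r‖ ≤ ∫ r in (0:ℝ)..t, M * Real.exp (w * r) := by
    refine intervalIntegral.norm_integral_le_of_norm_le ht ?_
      (Continuous.intervalIntegrable (by fun_prop) _ _)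
    filter_upwards with r hr using hM r hr.1.le
  have hd : ∀ r ∈ uIcc 0 t, HasDerivAt (fun r => M / w * Real.exp (w * r))
      (M * Real.exp (w * r)) r := by
    intro r _
    have := (((hasDerivAt_id r).const_mul w).exp).const_mul (M / w)
    refine this.congr_deriv ?_
    simp only [id]; field_simp
  rw [intervalIntegral.integral_eq_sub_of_hasDerivAt hd
    (Continuous.intervalIntegrable (by fun_prop) _ _)] at hb
  refine hb.trans ?_
  have : 0 ≤ M / w * Real.exp (w * 0) := by positivity
  linarith

lemma lapT_prim [CompleteSpace E] {w : ℝ} (hw : 0 < w) {f : ℝ → E} (hf : ExpB w f)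
    {s : ℂ} (hs : w < s.re) :
    lapT s (fun t => ∫ r in (0:ℝ)..t, f r) = s⁻¹ • lapT s f := by
  have hs0 : s ≠ 0 := by
    rintro rfl; simp at hs; linarith
  have hp := hf.prim hw
  have hd : ∀ t ∈ Ioi (0:ℝ), HasDerivAt
      (fun t : ℝ => Complex.exp (-(s * t)) • ∫ r in (0:ℝ)..t, f r)
      (Complex.exp (-(s * t)) • f t + (-s) • (Complex.exp (-(s * t)) • ∫ r in (0:ℝ)..t, f r)) t := by
    intro t _
    have a1 : HasDerivAt (fun t => ∫ r in (0:ℝ)..t, f r) (f t) t :=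
      intervalIntegral.integral_hasDerivAt_right (hf.1.intervalIntegrable _ _)
        (hf.1.stronglyMeasurableAtFilter _ _) hf.1.continuousAt
    have a2 : HasDerivAt (fun t : ℝ => Complex.exp (-(s * t))) (Complex.exp (-(s * t)) * (-s)) t := by
      have := (((hasDerivAt_id (t:ℂ)).const_mul s).neg.cexp).comp_ofReal
      simpa using this
    have := a2.smul a1
    refine this.congr_deriv ?_
    rw [smul_smul, mul_comm (-s)]
  have i1 := hf.integrable hs
  have i2 := (hp.integrable hs).smul (-s)
  have key := integral_Ioi_of_hasDerivAt_of_tendsto (m := 0)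
    (Continuous.continuousWithinAt (by have := hp.1; fun_prop)) hd (i1.add i2) (hp.tendsto hs)
  have e := integral_add (μ := volume.restrict (Ioi (0:ℝ))) i1 i2
  simp only [Pi.smul_apply] at e
  rw [e, integral_smul] at key
  simp only [intervalIntegral.integral_same, smul_zero, sub_zero] at key
  change lapT s f + (-s) • lapT s _ = 0 at key
  rw [eq_inv_smul_iff₀ hs0]
  rw [neg_smul, ← sub_eq_add_neg, sub_eq_zero] at key
  exact key.symm

lemma lapT_const [CompleteSpace E] (c : E) {s : ℂ} (hs : 0 < s.re) :
    lapT s (fun _ => c) = s⁻¹ • c := by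
  unfold lapT
  have hs0 : s ≠ 0 := by
    rintro rfl; simp at hs
  rw [integral_smul_const]
  have := integral_exp_mul_complex_Ioi (a := -s) (by simpa using hs) 0
  simp only [neg_mul] at this
  rw [this]
  simp

lemma lapT_unique [CompleteSpace E] {w σ : ℝ} (hσ : w < σ) {f : ℝ → E} (hf : ExpB w f)
    (h0 : f 0 = 0) (hl : ∀ s : ℂ, s.re = σ → lapT s f = 0) :
    ∀ t, 0 ≤ t → f t = 0 := by
  let F : ℝ → E := fun t => Complex.exp (-((σ : ℂ) * t)) • f (max t 0)
  have hFi : F = (Ioi (0:ℝ)).indicator (fun t : ℝ => Complex.exp (-((σ : ℂ) * t)) • f t) := by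
    ext t
    by_cases h : t ∈ Ioi (0:ℝ)
    · rw [indicator_of_mem h]; simp only [F]; rw [max_eq_left (le_of_lt h)]
    · rw [indicator_of_notMem h]; simp only [F]
      rw [max_eq_right (not_lt.1 h), h0, smul_zero]
  have hFc : Continuous F := by have := hf.1; fun_prop
  have hFint : Integrable F := by
    rw [hFi, integrable_indicator_iff measurableSet_Ioi]
    exact hf.integrable (s := σ) (by simpa using hσ)
  have hFour : FourierTransform.fourier F = fun _ => (0 : E) := by
    ext ξ
    rw [Real.fourier_eq]
    rw [← hl (σ + 2 * Real.pi * ξ * Complex.I) (by simp)]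
    unfold lapT
    rw [← integral_indicator measurableSet_Ioi, hFi]
    congr 1; ext t
    by_cases h : t ∈ Ioi (0:ℝ)
    · rw [indicator_of_mem h, indicator_of_mem h, Circle.smul_def, Real.fourierChar_apply,
        smul_smul, ← Complex.exp_add]
      congr 2
      simp
      ring
    · rw [indicator_of_notMem h, indicator_of_notMem h, smul_zero]
  intro t ht
  have := hFint.fourierInv_fourier_eq (by rw [hFour]; exact integrable_zero _ _ _)
    (hFc.continuousAt (x := t))
  rw [hFour, Real.fourierInv_eq] at this
  simp only [smul_zero, integral_zero, F] at this
  rw [max_eq_left ht] at this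
  exact (smul_eq_zero.1 this.symm).resolve_left (Complex.exp_ne_zero _)

/-- The kernel `t ↦ ∫ (t - r)₊ dh(r)`. -/
lemma aux_H_expB {w : ℝ} (hw : 0 < w) (μ : Measure ℝ) [IsFiniteMeasure μ] (hμ : μ (Iio 0) = 0)
    (g : ℝ → E) (hg : Integrable g μ) :
    ExpB w (fun t => ∫ r, max (t - r) 0 • g r ∂μ) := by
  have hμ' : ∀ᵐ r ∂μ, r ∉ Iio (0:ℝ) := measure_eq_zero_iff_ae_notMem.1 hμ
  have bd : ∀ t r : ℝ, 0 ≤ r → |max (t - r) 0| ≤ |t| := by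
    intro t r hr
    rw [abs_of_nonneg (le_max_right _ _)]
    exact max_le (by linarith [le_abs_self t]) (abs_nonneg _)
  constructor
  · rw [continuous_iff_continuousAt]
    intro t0
    refine continuousAt_of_dominated (bound := fun r => (|t0| + 1) * ‖g r‖) ?_ ?_
      (hg.norm.const_mul _) ?_
    · filter_upwards with t
      exact AEStronglyMeasurable.smul (𝕜 := ℝ) (f := fun r => max (t - r) 0)
        (Continuous.aestronglyMeasurable (by fun_prop)) hg.1
    · filter_upwards [Metric.ball_mem_nhds t0 one_pos] with t ht
      filter_upwards [hμ'] with r hr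
      rw [norm_smul, Real.norm_eq_abs]
      gcongr
      refine (bd t r (not_lt.1 hr)).trans ?_
      rw [Metric.mem_ball, Real.dist_eq] at ht
      have := abs_sub_abs_le_abs_sub t t0
      linarith
    · filter_upwards with r
      exact Continuous.continuousAt (by fun_prop)
  · refine ⟨(∫ r, ‖g r‖ ∂μ) / w, by positivity, fun t ht => ?_⟩
    have : ‖∫ r, max (t - r) 0 • g r ∂μ‖ ≤ ∫ r, t * ‖g r‖ ∂μ := by
      refine norm_integral_le_of_norm_le (hg.norm.const_mul _) ?_
      filter_upwards [hμ'] with r hr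
      rw [norm_smul, Real.norm_eq_abs]
      gcongr
      exact (bd t r (not_lt.1 hr)).trans_eq (abs_of_nonneg ht)
    refine this.trans ?_
    rw [integral_const_mul, div_mul_eq_mul_div, le_div_iff₀ hw]
    have h2 : w * t ≤ Real.exp (w * t) := by linarith [Real.add_one_le_exp (w * t)]
    have h3 : 0 ≤ ∫ r, ‖g r‖ ∂μ := by positivity
    nlinarith

lemma lapT_id {s : ℂ} (hs : 0 < s.re) : lapT s (fun t : ℝ => (t : ℂ)) = (s ^ 2)⁻¹ := by
  have h := lapT_prim (w := s.re / 2) (by linarith) (ExpB.const (by linarith) (1:ℂ))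
    (s := s) (by linarith)
  rw [lapT_const _ hs] at h
  simp only [intervalIntegral.integral_const, sub_zero] at h
  simp only [Complex.real_smul, mul_one] at h
  rw [h]; simp [pow_two]

lemma lapT_H [CompleteSpace E] (μ : Measure ℝ) [IsFiniteMeasure μ] (hμ : μ (Iio 0) = 0)
    (g : ℝ → E) (hg : Integrable g μ) {s : ℂ} (hs : 0 < s.re) :
    lapT s (fun t => ∫ r, max (t - r) 0 • g r ∂μ)
      = (s ^ 2)⁻¹ • ∫ r, Complex.exp (-(s * r)) • g r ∂μ := by
  have hμ' : ∀ᵐ r ∂μ, r ∉ Iio (0:ℝ) := measure_eq_zero_iff_ae_notMem.1 hμ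
  have hid : ExpB (s.re / 2) (fun t : ℝ => (t : ℂ)) := by
    have := (ExpB.const (w := s.re / 2) (by linarith) (1:ℂ)).prim (by linarith)
    simpa using this
  have hidi := hid.integrable (s := s) (by linarith)
  have hF : Integrable (Function.uncurry fun t r : ℝ =>
      Complex.exp (-(s * t)) • max (t - r) 0 • g r) ((volume.restrict (Ioi 0)).prod μ) := by
    have hprod := Integrable.mul_prod hidi.norm hg.norm
    refine Integrable.mono' hprod ?_ ?_
    · refine AEStronglyMeasurable.smul (Continuous.aestronglyMeasurable (by fun_prop)) ?_
      exact AEStronglyMeasurable.smul (𝕜 := ℝ) (f := fun a : ℝ × ℝ => max (a.1 - a.2) 0)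
        (Continuous.aestronglyMeasurable (by fun_prop))
        hg.1.comp_snd
    · have m1 : ∀ᵐ z ∂((volume.restrict (Ioi (0:ℝ))).prod μ), z.1 ∈ Ioi (0:ℝ) :=
        Measure.quasiMeasurePreserving_fst.ae (ae_restrict_mem measurableSet_Ioi)
      have m2 : ∀ᵐ z ∂((volume.restrict (Ioi (0:ℝ))).prod μ), z.2 ∉ Iio (0:ℝ) :=
        Measure.quasiMeasurePreserving_snd.ae hμ'
      filter_upwards [m1, m2] with z h1 h2
      simp only [Function.uncurry]
      rw [norm_smul, norm_smul, norm_smul, mul_assoc]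
      gcongr
      rw [Real.norm_eq_abs, abs_of_nonneg (le_max_right _ _), Complex.norm_real, Real.norm_eq_abs,
        abs_of_pos h1]
      simp only [mem_Iio, not_lt] at h2
      exact max_le (by linarith) (le_of_lt h1)
  unfold lapT
  calc _ = ∫ t in Ioi (0:ℝ), ∫ r, Complex.exp (-(s * t)) • max (t - r) 0 • g r ∂μ := by
        simp_rw [integral_smul]
    _ = ∫ r, ∫ t in Ioi (0:ℝ), Complex.exp (-(s * t)) • max (t - r) 0 • g r ∂volume ∂μ :=
        integral_integral_swap hF
    _ = ∫ r, (s ^ 2)⁻¹ • Complex.exp (-(s * r)) • g r ∂μ := by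
        apply integral_congr_ae
        filter_upwards [hμ'] with r hr
        simp only [mem_Iio, not_lt] at hr
        have e1 : ∀ t : ℝ, Complex.exp (-(s * t)) • max (t - r) 0 • g r
            = (Complex.exp (-(s * t)) * ((max (t - r) 0 : ℝ) : ℂ)) • g r := by
          intro t
          rw [mul_smul, Complex.coe_smul]
        simp_rw [e1]
        rw [integral_smul_const, smul_smul]
        congr 1
        rw [← lapT_id hs]
        have e2 : ∫ t in Ioi (0:ℝ), Complex.exp (-(s * t)) * ((max (t - r) 0 : ℝ) : ℂ)
            = ∫ t in Ioi r, Complex.exp (-(s * t)) * ((max (t - r) 0 : ℝ) : ℂ) := by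
          refine setIntegral_eq_of_subset_of_forall_sdiff_eq_zero measurableSet_Ioi
            (Ioi_subset_Ioi hr) ?_
          intro x hx
          have : x ≤ r := not_lt.1 hx.2
          rw [max_eq_right (by linarith)]; simp
        rw [e2]
        have e3 := (measurePreserving_add_right (volume : Measure ℝ) r).setIntegral_preimage_emb
          (measurableEmbedding_addRight r)
          (fun t : ℝ => Complex.exp (-(s * t)) * ((max (t - r) 0 : ℝ) : ℂ)) (Ioi r)
        have e4 : (fun x : ℝ => x + r) ⁻¹' Ioi r = Ioi 0 := by ext x; simp
        rw [e4] at e3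
        rw [← e3]
        unfold lapT
        rw [← integral_mul_const]
        apply setIntegral_congr_fun measurableSet_Ioi
        intro t ht
        simp only [add_sub_cancel_right]
        rw [max_eq_left (le_of_lt ht)]
        simp only [smul_eq_mul]
        push_cast
        rw [mul_add, neg_add, Complex.exp_add]
        ring
    _ = _ := integral_smul _ _

end AuxLap
section AuxSem

open Filter

lemma C0Semigroup.expBound {X : Type*} [NormedAddCommGroup X] [NormedSpace ℂ X] [CompleteSpace X]
    (S : C0Semigroup X) :
    ∃ w M : ℝ, 0 < w ∧ 0 ≤ M ∧ ∀ t : ℝ, 0 ≤ t → ‖S.T t‖ ≤ M * Real.exp (w * t) := by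
  obtain ⟨C, hC⟩ := banach_steinhaus (g := fun t : Icc (0:ℝ) 1 => S.T t) (by
    intro x
    obtain ⟨C, hC⟩ := isCompact_Icc.exists_bound_of_continuousOn
      ((S.strongly_continuous x).mono (show Icc (0:ℝ) 1 ⊆ Ici 0 from Icc_subset_Ici_self))
    exact ⟨C, fun t => hC t t.2⟩)
  set M := max C 2 with hM
  have hM2 : 2 ≤ M := le_max_right _ _
  have hMC : ∀ t : ℝ, 0 ≤ t → t ≤ 1 → ‖S.T t‖ ≤ M := fun t h0 h1 =>
    (hC ⟨t, h0, h1⟩).trans (le_max_left _ _)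
  have hn : ∀ n : ℕ, ∀ t : ℝ, 0 ≤ t → t ≤ 1 → ‖S.T (n + t)‖ ≤ M * M ^ n := by
    intro n
    induction n with
    | zero => intro t h0 h1; simpa using hMC t h0 h1
    | succ n ih =>
      intro t h0 h1
      have : ((n + 1 : ℕ) : ℝ) + t = 1 + (n + t) := by push_cast; ring
      rw [this, S.map_add 1 (n + t) zero_le_one (by positivity)]
      calc _ ≤ ‖S.T 1‖ * ‖S.T (n + t)‖ := ContinuousLinearMap.opNorm_comp_le _ _
        _ ≤ M * (M * M ^ n) := by
          gcongr
          · exact hMC 1 zero_le_one le_rfl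
          · exact ih t h0 h1
        _ = _ := by ring
  have hlog : 0 < Real.log M := Real.log_pos (by linarith)
  refine ⟨Real.log M, M, hlog, by linarith, fun t ht => ?_⟩
  have h1 := hn ⌊t⌋₊ (t - ⌊t⌋₊) (sub_nonneg.2 (Nat.floor_le ht))
    (by linarith [Nat.lt_floor_add_one t])
  rw [add_sub_cancel] at h1
  refine h1.trans ?_
  gcongr
  calc M ^ ⌊t⌋₊ = Real.exp (Real.log M * ⌊t⌋₊) := by
        rw [← Real.rpow_natCast, Real.rpow_def_of_pos (by linarith)]
    _ ≤ _ := by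
        apply Real.exp_le_exp.2
        gcongr
        exact Nat.floor_le ht

namespace SystemNode

set_option linter.unusedSectionVars false

variable {U X Xm1 Y : Type*}
  [NormedAddCommGroup U] [NormedSpace ℂ U] [FiniteDimensional ℂ U]
  [NormedAddCommGroup X] [NormedSpace ℂ X] [CompleteSpace X]
  [NormedAddCommGroup Xm1] [NormedSpace ℂ Xm1]
  [NormedAddCommGroup Y] [NormedSpace ℂ Y] [FiniteDimensional ℂ Y]
  (sys : SystemNode U X Xm1 Y)

lemma R_Am1 {s : ℂ} (hs : sys.S.growthBound < s.re) (x : X) :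
    sys.R s (sys.Am1 x) = s • sys.R s (sys.ι x) - x := by
  have := sys.R_left s hs x
  rw [map_sub, map_smul] at this
  exact (sub_eq_iff_eq_add.2 (by rw [← sub_eq_iff_eq_add'.1 this])).symm

lemma R_resolvent {s β : ℂ} (hs : sys.S.growthBound < s.re) (hβ : sys.S.growthBound < β.re)
    (z : Xm1) : sys.R s z - sys.R β z = (β - s) • sys.R s (sys.ι (sys.R β z)) := by
  have h1 : sys.R s z = sys.R s (β • sys.ι (sys.R β z) - sys.Am1 (sys.R β z)) := by
    rw [sys.R_right β hβ z]
  rw [map_sub, map_smul, sys.R_Am1 hs] at h1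
  rw [h1, sub_smul]; abel

lemma Am1_comm {t : ℝ} (ht : 0 ≤ t) (x : X) :
    sys.Sm1.T t (sys.Am1 x) = sys.Am1 (sys.S.T t x) := by
  have h0 := sys.generator x 0 le_rfl
  rw [sys.S.map_zero] at h0
  have h1 : HasDerivWithinAt (fun τ : ℝ => sys.Sm1.T t (sys.ι (sys.S.T τ x)))
      (sys.Sm1.T t (sys.Am1 x)) (Ici 0) 0 :=
    ((sys.Sm1.T t).restrictScalars ℝ).hasFDerivAt.comp_hasDerivWithinAt 0 h0
  have h2 := sys.generator (sys.S.T t x) 0 le_rfl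
  rw [sys.S.map_zero] at h2
  have h3 : HasDerivWithinAt (fun τ : ℝ => sys.Sm1.T t (sys.ι (sys.S.T τ x)))
      (sys.Am1 (sys.S.T t x)) (Ici 0) 0 := by
    refine h2.congr ?_ ?_
    · intro τ hτ
      rw [sys.semigroup_compat t ht]
      have e : sys.S.T t (sys.S.T τ x) = sys.S.T τ (sys.S.T t x) := by
        have a := sys.S.map_add t τ ht hτ
        have b := sys.S.map_add τ t hτ ht
        rw [add_comm, b] at a
        exact (DFunLike.congr_fun a x).symm
      rw [e]
    · rw [sys.semigroup_compat t ht, sys.S.map_zero]; simp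
  exact (uniqueDiffWithinAt_Ici (0:ℝ)).eq_deriv _ h1 h3

lemma R_comm {s : ℂ} (hs : sys.S.growthBound < s.re) {t : ℝ} (ht : 0 ≤ t) (z : Xm1) :
    sys.R s (sys.Sm1.T t z) = sys.S.T t (sys.R s z) := by
  nth_rw 1 [← sys.R_right s hs z]
  rw [map_sub, map_smul, sys.semigroup_compat t ht, sys.Am1_comm ht, sys.R_left s hs]

lemma J_deriv {s : ℂ} (hs : sys.S.growthBound < s.re) {t : ℝ} (ht : 0 ≤ t) (x : X) :
    HasDerivWithinAt (fun τ : ℝ => sys.R s (sys.ι (sys.S.T τ x)))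
      (s • sys.R s (sys.ι (sys.S.T t x)) - sys.S.T t x) (Ici 0) t := by
  rw [← sys.R_Am1 hs]
  exact ((sys.R s).restrictScalars ℝ).hasFDerivAt.comp_hasDerivWithinAt t (sys.generator x t ht)

/-- The resolvent on `X`. -/
noncomputable def Jop (s : ℂ) : X →L[ℂ] X := (sys.R s).comp sys.ι

lemma Jop_inj {s : ℂ} (hs : sys.S.growthBound < s.re) {x : X} (hx : sys.Jop s x = 0) : x = 0 := by
  have h := sys.R_right s hs (sys.ι x)
  have hx' : sys.R s (sys.ι x) = 0 := hx
  rw [hx'] at h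
  simp only [map_zero, smul_zero, sub_zero] at h
  exact sys.ι_injective (by simpa using h.symm)

/-- The operator `T(t) b`, extended constantly to negative times. -/
noncomputable def Fop (b : U →L[ℂ] X) (t : ℝ) : U →L[ℂ] X := (sys.S.T (max t 0)).comp b

lemma Fop_continuous (b : U →L[ℂ] X) : Continuous (sys.Fop b) := by
  rw [continuous_clm_apply]
  intro u
  have h1 := sys.S.strongly_continuous (b u)
  rw [continuousOn_iff_continuous_domRestrict] at h1
  exact h1.comp (f := fun t : ℝ => (⟨max t 0, mem_Ici.2 (le_max_right t 0)⟩ : Ici (0:ℝ)))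
    (Continuous.subtype_mk (by fun_prop) _)

lemma Fop_expB (b : U →L[ℂ] X) : ∃ w : ℝ, 0 < w ∧ ExpB w (sys.Fop b) := by
  obtain ⟨w, M, hw, hM0, hM⟩ := sys.S.expBound
  refine ⟨w, hw, sys.Fop_continuous b, M * ‖b‖, by positivity, fun t ht => ?_⟩
  unfold Fop
  rw [max_eq_left ht]
  refine (ContinuousLinearMap.opNorm_comp_le _ _).trans ?_
  rw [mul_right_comm]
  gcongr
  exact hM t ht

lemma Fop_deriv {s : ℂ} (hs : sys.S.growthBound < s.re) (b : U →L[ℂ] X) (u : U) {t : ℝ}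
    (ht : 0 < t) :
    HasDerivAt (fun τ : ℝ => sys.Jop s (sys.Fop b τ u))
      (s • sys.Jop s (sys.Fop b t u) - sys.Fop b t u) t := by
  have h := (sys.J_deriv hs ht.le (b u)).hasDerivAt (Ici_mem_nhds ht)
  have e : sys.Fop b t u = sys.S.T t (b u) := by simp [Fop, max_eq_left ht.le]
  rw [e]
  refine h.congr_of_eventuallyEq ?_
  filter_upwards [Ioi_mem_nhds ht] with τ hτ
  have hτ' : 0 ≤ τ := le_of_lt (mem_Ioi.1 hτ)
  simp [Fop, max_eq_left hτ', Jop]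

lemma Fop_zero (b : U →L[ℂ] X) : sys.Fop b 0 = b := by
  ext u; simp [Fop, sys.S.map_zero]

/-- composition with the resolvent -/
noncomputable def JJ (s : ℂ) : (U →L[ℂ] X) →L[ℂ] (U →L[ℂ] X) :=
  ContinuousLinearMap.compL ℂ U X X (sys.Jop s)

lemma JJ_apply (s : ℂ) (f : U →L[ℂ] X) (u : U) : sys.JJ s f u = sys.Jop s (f u) := rfl

lemma lapT_Fop {w : ℝ} (b : U →L[ℂ] X) (hF : ExpB w (sys.Fop b)) {s : ℂ}
    (hs : sys.S.growthBound < s.re) (hws : w < s.re) :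
    lapT s (sys.Fop b) = sys.JJ s b := by
  ext u
  have hFu : ExpB w (fun t => sys.Fop b t u) :=
    hF.clm (ContinuousLinearMap.apply ℂ X u)
  have e0 : lapT s (sys.Fop b) u = lapT s (fun t => sys.Fop b t u) :=
    (lapT_clm hF (ContinuousLinearMap.apply ℂ X u) hws).symm
  have hJ := hFu.clm (sys.Jop s)
  have hd : ∀ t ∈ Ioi (0:ℝ), HasDerivAt
      (fun t : ℝ => Complex.exp (-(s * t)) • sys.Jop s (sys.Fop b t u))
      (-(Complex.exp (-(s * t)) • sys.Fop b t u)) t := by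
    intro t ht
    have a2 : HasDerivAt (fun t : ℝ => Complex.exp (-(s * t))) (Complex.exp (-(s * t)) * (-s)) t := by
      have := (((hasDerivAt_id (t:ℂ)).const_mul s).neg.cexp).comp_ofReal
      simpa using this
    have := a2.smul (sys.Fop_deriv hs b u ht)
    refine this.congr_deriv ?_
    module
  have key := integral_Ioi_of_hasDerivAt_of_tendsto (m := 0)
    (Continuous.continuousWithinAt (by have := hJ.1; fun_prop)) hd
    (hFu.integrable hws).neg (hJ.tendsto hws)
  rw [integral_neg] at key
  rw [e0, sys.JJ_apply]
  unfold lapT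
  rw [← neg_inj, key]
  simp [Fop_zero]

/-- first primitive -/
noncomputable def I1 (b : U →L[ℂ] X) (t : ℝ) : U →L[ℂ] X := ∫ r in (0:ℝ)..t, sys.Fop b r
/-- second primitive -/
noncomputable def I2 (b : U →L[ℂ] X) (t : ℝ) : U →L[ℂ] X := ∫ r in (0:ℝ)..t, sys.I1 b r

lemma I1_continuous (b : U →L[ℂ] X) : Continuous (sys.I1 b) :=
  intervalIntegral.continuous_primitive
    (fun a c => (sys.Fop_continuous b).intervalIntegrable a c) 0

lemma I2_continuous (b : U →L[ℂ] X) : Continuous (sys.I2 b) :=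
  intervalIntegral.continuous_primitive
    (fun a c => (sys.I1_continuous b).intervalIntegrable a c) 0

lemma I1_id {s : ℂ} (hs : sys.S.growthBound < s.re) (b : U →L[ℂ] X) {t : ℝ} (ht : 0 ≤ t) :
    sys.JJ s (sys.Fop b t) = sys.JJ s b + s • sys.JJ s (sys.I1 b t) - sys.I1 b t := by
  have hc := sys.Fop_continuous b
  have hi : IntervalIntegrable (sys.Fop b) volume 0 t := hc.intervalIntegrable _ _
  ext u
  have hcu : Continuous fun t => sys.Fop b t u := by fun_prop
  have hI : sys.I1 b t u = ∫ r in (0:ℝ)..t, sys.Fop b r u :=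
    ContinuousLinearMap.intervalIntegral_apply hi u
  have key := intervalIntegral.integral_eq_sub_of_hasDerivAt_of_le ht
    (f := fun τ : ℝ => sys.Jop s (sys.Fop b τ u))
    (Continuous.continuousOn (by fun_prop)) (fun x hx => sys.Fop_deriv hs b u hx.1)
    (Continuous.intervalIntegrable (by fun_prop) _ _)
  rw [intervalIntegral.integral_sub (Continuous.intervalIntegrable (by fun_prop) _ _)
    (Continuous.intervalIntegrable (by fun_prop) _ _), intervalIntegral.integral_smul,
    ContinuousLinearMap.intervalIntegral_comp_comm _ (hcu.intervalIntegrable _ _), ← hI,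
    sys.Fop_zero] at key
  simp only [_root_.sub_apply, _root_.add_apply,
    _root_.smul_apply, JJ_apply]
  rw [add_sub_assoc, key]; abel

lemma I2_id {s : ℂ} (hs : sys.S.growthBound < s.re) (b : U →L[ℂ] X) {t : ℝ} (ht : 0 ≤ t) :
    sys.JJ s (sys.I1 b t) = (t : ℂ) • sys.JJ s b + s • sys.JJ s (sys.I2 b t) - sys.I2 b t := by
  have hc := sys.Fop_continuous b
  have hc1 := sys.I1_continuous b
  have e1 : sys.JJ s (sys.I1 b t) = ∫ r in (0:ℝ)..t, sys.JJ s (sys.Fop b r) :=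
    (ContinuousLinearMap.intervalIntegral_comp_comm _ (hc.intervalIntegrable _ _)).symm
  have e2 : ∫ r in (0:ℝ)..t, sys.JJ s (sys.Fop b r)
      = ∫ r in (0:ℝ)..t, ((sys.JJ s b + s • sys.JJ s (sys.I1 b r)) - sys.I1 b r) := by
    apply intervalIntegral.integral_congr
    intro r hr
    rw [uIcc_of_le ht] at hr
    exact sys.I1_id hs b hr.1
  rw [e1, e2, intervalIntegral.integral_sub (Continuous.intervalIntegrable (by fun_prop) _ _)
    (Continuous.intervalIntegrable (by fun_prop) _ _),
    intervalIntegral.integral_add (Continuous.intervalIntegrable (by fun_prop) _ _)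
    (Continuous.intervalIntegrable (by fun_prop) _ _), intervalIntegral.integral_smul,
    ContinuousLinearMap.intervalIntegral_comp_comm _ (hc1.intervalIntegrable _ _),
    intervalIntegral.integral_const, sub_zero, Complex.coe_smul]
  rfl

/-- The kernel `(β - A) q(t)`. -/
noncomputable def Pop (β : ℂ) (b : U →L[ℂ] X) (t : ℝ) : U →L[ℂ] X :=
  (β ^ 2) • sys.I2 b t + ((-2 * β) • sys.I1 b t + (sys.Fop b t +
    (β • (∫ _ in (0:ℝ)..t, b) + (-1 : ℂ) • b)))

lemma Pop_id {β : ℂ} (hβ : sys.S.growthBound < β.re) (b : U →L[ℂ] X) {t : ℝ} (ht : 0 ≤ t) :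
    sys.JJ β (sys.JJ β (sys.Pop β b t)) = sys.I2 b t - (t : ℂ) • sys.JJ β b := by
  have h1 : sys.JJ β (sys.Pop β b t) = β • sys.I2 b t - sys.I1 b t := by
    unfold Pop
    rw [intervalIntegral.integral_const, sub_zero, ← Complex.coe_smul]
    simp only [map_add, map_smul]
    rw [sys.I1_id hβ b ht, sys.I2_id hβ b ht]
    module
  rw [h1, map_sub, map_smul, sys.I2_id hβ b ht]
  module

lemma Pop_expB {w : ℝ} (hw : 0 < w) (β : ℂ) (b : U →L[ℂ] X) (hF : ExpB w (sys.Fop b)) :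
    ExpB w (sys.Pop β b) := by
  have h1 : ExpB w (sys.I1 b) := hF.prim hw
  have h2 : ExpB w (sys.I2 b) := h1.prim hw
  exact (h2.smul _).add ((h1.smul _).add (hF.add
    ((((ExpB.const hw b).prim hw).smul _).add ((ExpB.const hw b).smul _))))

lemma lapT_Pop {w : ℝ} (hw : 0 < w) (β : ℂ) (b : U →L[ℂ] X) (hF : ExpB w (sys.Fop b)) {s : ℂ}
    (hs : sys.S.growthBound < s.re) (hws : w < s.re) :
    lapT s (sys.Pop β b) = (s ^ 2)⁻¹ • ((β - s) ^ 2 • sys.JJ s b + (β - s) • b) := by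
  have hs0 : s ≠ 0 := by
    rintro rfl; simp at hws; linarith
  have h1 : ExpB w (sys.I1 b) := hF.prim hw
  have h2 : ExpB w (sys.I2 b) := h1.prim hw
  have hb := ExpB.const hw b
  have hb1 := hb.prim hw
  have l0 := sys.lapT_Fop b hF hs hws
  have l1 : lapT s (sys.I1 b) = s⁻¹ • sys.JJ s b := by rw [← l0]; exact lapT_prim hw hF hws
  have l2 : lapT s (sys.I2 b) = s⁻¹ • s⁻¹ • sys.JJ s b := by rw [← l1]; exact lapT_prim hw h1 hws
  have lb := lapT_const b (s := s) (by linarith)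
  have lb1 := lapT_prim hw hb hws
  rw [lb] at lb1
  unfold Pop
  rw [lapT_add (h2.smul _) ((h1.smul _).add (hF.add ((hb1.smul _).add (hb.smul _)))) hws,
    lapT_add (h1.smul _) (hF.add ((hb1.smul _).add (hb.smul _))) hws,
    lapT_add hF ((hb1.smul _).add (hb.smul _)) hws,
    lapT_add (hb1.smul _) (hb.smul _) hws, lapT_smul, lapT_smul, lapT_smul, lapT_smul,
    l0, l1, l2, lb, lb1]
  simp only [smul_smul, smul_add]
  have a1 : (s ^ 2)⁻¹ * (β - s) ^ 2 = β ^ 2 * (s⁻¹ * s⁻¹) + (-2 * β) * s⁻¹ + 1 := by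
    field_simp; ring
  have a2 : (s ^ 2)⁻¹ * (β - s) = β * (s⁻¹ * s⁻¹) + (-1) * s⁻¹ := by
    field_simp; ring
  rw [a1, a2]
  module

/-- The bounded operator `C (β - A)⁻¹ : X → Y`. -/
lemma exists_Cbeta {β : ℂ} (hβ : sys.S.growthBound < β.re) :
    ∃ Cb : X →L[ℂ] Y, ∀ x, Cb x = sys.Cop (sys.Jop β x) := by
  have hdom : ∀ x, sys.Am1 (sys.Jop β x) = sys.ι (β • sys.Jop β x - x) := by
    intro x
    have := sys.R_right β hβ (sys.ι x)
    rw [map_sub, map_smul]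
    rw [sub_eq_iff_eq_add] at this
    exact (sub_eq_of_eq_add' this).symm
  obtain ⟨M, hM⟩ := sys.Cop_bound
  let L : X →ₗ[ℂ] Y :=
    { toFun := fun x => sys.Cop (sys.Jop β x)
      map_add' := fun x y => by
        rw [map_add]
        exact sys.Cop_add _ _ ⟨_, hdom x⟩ ⟨_, hdom y⟩
      map_smul' := fun a x => by
        rw [map_smul]
        exact sys.Cop_smul _ _ ⟨_, hdom x⟩ }
  refine ⟨L.mkContinuous (|M| * (‖sys.Jop β‖ + (‖β‖ * ‖sys.Jop β‖ + 1))) ?_, fun x => rfl⟩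
  intro x
  have h1 := (sys.Jop β).le_opNorm x
  calc ‖sys.Cop (sys.Jop β x)‖ ≤ M * (‖sys.Jop β x‖ + ‖β • sys.Jop β x - x‖) := hM _ _ (hdom x)
    _ ≤ |M| * (‖sys.Jop β x‖ + ‖β • sys.Jop β x - x‖) := by gcongr; exact le_abs_self M
    _ ≤ |M| * (‖sys.Jop β‖ * ‖x‖ + (‖β‖ * (‖sys.Jop β‖ * ‖x‖) + ‖x‖)) := by
        gcongr
        refine (norm_sub_le _ _).trans ?_
        rw [norm_smul]
        gcongr
    _ = _ := by ring

lemma kernel_eq {β : ℂ} (hβ : sys.S.growthBound < β.re) (Cb : X →L[ℂ] Y)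
    (hCb : ∀ x, Cb x = sys.Cop (sys.Jop β x))
    (h : BVMeasure U Y) (hG : LaplaceMatches sys h) (hg : Integrable h.g h.μ) {t : ℝ} (ht : 0 ≤ t) :
    Cb.comp (sys.Pop β ((sys.R β).comp sys.B) t) + (t : ℂ) • sys.G β
      = ∫ r, max (t - r) 0 • h.g r ∂h.μ := by
  have := h.finite
  have : CompleteSpace Y := FiniteDimensional.complete ℂ Y
  set b : U →L[ℂ] X := (sys.R β).comp sys.B with hb
  obtain ⟨w, hw, hF⟩ := sys.Fop_expB b
  let CC : (U →L[ℂ] X) →L[ℂ] (U →L[ℂ] Y) := ContinuousLinearMap.compL ℂ U X Y Cb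
  have hP := sys.Pop_expB hw β b hF
  have hH := aux_H_expB hw h.μ h.supported h.g hg
  have hGc := ExpB.const hw (sys.G β)
  have hG1 := hGc.prim hw
  set f : ℝ → (U →L[ℂ] Y) := fun t => CC (sys.Pop β b t) + ((∫ _ in (0:ℝ)..t, sys.G β)
    + (-1 : ℂ) • ∫ r, max (t - r) 0 • h.g r ∂h.μ) with hf
  have hfe : ExpB w f := (hP.clm CC).add (hG1.add (hH.smul _))
  have hμ' : ∀ᵐ r ∂h.μ, r ∉ Iio (0:ℝ) := measure_eq_zero_iff_ae_notMem.1 h.supported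
  have hf0 : f 0 = 0 := by
    have e1 : ∫ r, max (0 - r) 0 • h.g r ∂h.μ = 0 := by
      apply integral_eq_zero_of_ae
      filter_upwards [hμ'] with r hr
      simp only [mem_Iio, not_lt] at hr
      rw [max_eq_right (by linarith)]; simp
    have e2 : sys.Pop β b 0 = 0 := by
      simp [Pop, I1, I2, Fop_zero]
    simp only [hf, e1, e2]; simp
  set σ : ℝ := max w (max sys.S.growthBound 0) + 1 with hσ
  have hσw : w < σ := by have := le_max_left w (max sys.S.growthBound 0); linarith
  have hσg : sys.S.growthBound < σ := by
    have := le_max_right w (max sys.S.growthBound 0)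
    have := le_max_left sys.S.growthBound 0
    linarith
  have hz := lapT_unique hσw hfe hf0 (by
    intro s hsσ
    have hsw : w < s.re := hsσ ▸ hσw
    have hsg : sys.S.growthBound < s.re := hsσ ▸ hσg
    have hs0 : 0 < s.re := hw.trans hsw
    rw [hf, lapT_add (hP.clm CC) (hG1.add (hH.smul _)) hsw, lapT_add hG1 (hH.smul _) hsw,
      lapT_smul, lapT_clm hP CC hsw, lapT_prim hw hGc hsw, lapT_const _ hs0,
      lapT_H h.μ h.supported h.g hg hs0, sys.lapT_Pop hw β b hF hsg hsw]
    ext u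
    have e1 : (∫ r, Complex.exp (-(s * r)) • h.g r ∂h.μ) u = sys.G s u := by
      rw [ContinuousLinearMap.integral_apply]
      · exact hG s hsg hs0.le u
      · refine Integrable.bdd_smul (φ := fun r : ℝ => Complex.exp (-(s * r))) hg 1
          (Continuous.aestronglyMeasurable (by fun_prop)) ?_
        filter_upwards [hμ'] with r hr
        simp only [mem_Iio, not_lt] at hr
        rw [norm_cexp_aux]
        exact Real.exp_le_one_iff.2 (by nlinarith)
    have e2 : Cb ((β - s) ^ 2 • sys.Jop s (b u) + (β - s) • b u) = sys.G s u - sys.G β u := by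
      rw [hCb, sys.G_shift s β hsg hβ u]
      congr 1
      have r1 := sys.R_resolvent hsg hβ (sys.B u)
      have r2 := sys.R_resolvent hβ hsg (sys.ι (b u))
      rw [r1]
      change sys.Jop β (b u) - sys.Jop s (b u) = (s - β) • sys.Jop β (sys.Jop s (b u)) at r2
      change _ = (β - s) • sys.Jop s (b u)
      rw [map_add, map_smul, map_smul]
      rw [sub_eq_iff_eq_add] at r2
      rw [r2]
      module
    change Cb ((s ^ 2)⁻¹ • ((β - s) ^ 2 • sys.Jop s (b u) + (β - s) • b u)) +
      (s⁻¹ • s⁻¹ • sys.G β u + (-1 : ℂ) • (s ^ 2)⁻¹ •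
        (∫ r, Complex.exp (-(s * r)) • h.g r ∂h.μ) u) = 0
    rw [e1, map_smul, e2, smul_smul s⁻¹, ← mul_inv, ← pow_two]
    module) t ht
  simp only [hf] at hz
  rw [intervalIntegral.integral_const, sub_zero, ← Complex.coe_smul, ← add_assoc, neg_one_smul,
    ← sub_eq_add_neg, sub_eq_zero] at hz
  exact hz

end SystemNode

end AuxSem
section AuxFinal

namespace SystemNode

set_option linter.unusedSectionVars false

variable {U X Xm1 Y : Type*}
  [NormedAddCommGroup U] [NormedSpace ℂ U] [FiniteDimensional ℂ U]
  [NormedAddCommGroup X] [NormedSpace ℂ X] [CompleteSpace X]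
  [NormedAddCommGroup Xm1] [NormedSpace ℂ Xm1] [CompleteSpace Xm1]
  [NormedAddCommGroup Y] [NormedSpace ℂ Y] [FiniteDimensional ℂ Y]
  (sys : SystemNode U X Xm1 Y)

lemma I2_eq (b : U →L[ℂ] X) {t τ : ℝ} (h0 : 0 ≤ τ) (h1 : τ ≤ t) :
    ∫ r in Icc 0 t, max (τ - r) 0 • sys.Fop b r = sys.I2 b τ := by
  have e1 : ∫ r in Icc 0 t, max (τ - r) 0 • sys.Fop b r
      = ∫ r in (0:ℝ)..τ, (τ - r) • sys.Fop b r := by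
    rw [intervalIntegral.integral_of_le h0, ← integral_Icc_eq_integral_Ioc,
      ← integral_indicator measurableSet_Icc, ← integral_indicator measurableSet_Icc]
    congr 1
    ext1 r
    by_cases hr : r ∈ Icc 0 τ
    · rw [indicator_of_mem hr, indicator_of_mem (show r ∈ Icc 0 t from ⟨hr.1, hr.2.trans h1⟩),
        max_eq_left (by linarith [hr.2])]
    · rw [indicator_of_notMem hr]
      by_cases hr' : r ∈ Icc 0 t
      · rw [indicator_of_mem hr']
        have : τ < r := by
          by_contra hh
          exact hr ⟨hr'.1, not_lt.1 hh⟩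
        rw [max_eq_right (by linarith), zero_smul]
      · rw [indicator_of_notMem hr']
  rw [e1]
  have hF := sys.Fop_continuous b
  have hI := sys.I1_continuous b
  have hd : ∀ r ∈ uIcc 0 τ, HasDerivAt (fun r => (τ - r) • sys.I1 b r)
      ((τ - r) • sys.Fop b r - sys.I1 b r) r := by
    intro r _
    have h2 : HasDerivAt (sys.I1 b) (sys.Fop b r) r :=
      intervalIntegral.integral_hasDerivAt_right (hF.intervalIntegrable _ _)
        (hF.stronglyMeasurableAtFilter _ _) hF.continuousAt
    have h3 : HasDerivAt (fun r : ℝ => τ - r) (-1) r := by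
      simpa using (hasDerivAt_id r).const_sub τ
    have := h3.smul h2
    refine this.congr_deriv ?_
    rw [neg_one_smul, ← sub_eq_add_neg]
  have c1 : Continuous fun r => (τ - r) • sys.Fop b r := by fun_prop
  have key := intervalIntegral.integral_eq_sub_of_hasDerivAt hd
    ((c1.sub hI).intervalIntegrable _ _)
  rw [intervalIntegral.integral_sub (c1.intervalIntegrable _ _) (hI.intervalIntegrable _ _)] at key
  have hz : sys.I1 b 0 = 0 := by simp [I1]
  rw [hz] at key
  simp only [sub_self, zero_smul, smul_zero] at key
  rw [sub_eq_zero] at key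
  exact key

lemma ker_intervalIntegrable {E : Type*} [NormedAddCommGroup E] [NormedSpace ℂ E]
    (A : ℝ → U →L[ℂ] E) (hA : Continuous A) (u : ℝ → U) (t : ℝ) (ht : 0 ≤ t)
    (hu : IntegrableOn u (Icc 0 t)) :
    IntervalIntegrable (fun s => A (t - s) (u s)) volume 0 t := by
  rw [intervalIntegrable_iff_integrableOn_Icc_of_le ht]
  have hA' : Continuous fun s => A (t - s) := hA.comp (continuous_const.sub continuous_id)
  obtain ⟨C, hC⟩ := isCompact_Icc.exists_bound_of_continuousOn (s := Icc 0 t) hA'.continuousOn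
  refine Integrable.mono' (hu.norm.const_mul C) ?_ ?_
  · exact (isBoundedBilinearMap_apply (𝕜 := ℂ) (E := U) (F := E)).continuous.comp_aestronglyMeasurable
      (hA'.aestronglyMeasurable.prodMk hu.1)
  · refine (ae_restrict_iff' measurableSet_Icc).2 (Filter.Eventually.of_forall fun s hs => ?_)
    exact ((A (t - s)).le_opNorm _).trans (by gcongr; exact hC s hs)

lemma ker_int_smul {E : Type*} [NormedAddCommGroup E] [NormedSpace ℂ E]
    (D : U →L[ℂ] E) (u : ℝ → U) (t : ℝ) (ht : 0 ≤ t) (hu : IntegrableOn u (Icc 0 t)) :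
    IntervalIntegrable (fun s => (((t - s : ℝ) : ℂ) • D) (u s)) volume 0 t :=
  ker_intervalIntegrable (fun τ : ℝ => (τ : ℂ) • D) (by fun_prop) u t ht hu

end SystemNode

lemma BVMeasure.g_integrable {U Y : Type*} [NormedAddCommGroup U] [NormedSpace ℂ U]
    [NormedAddCommGroup Y] [NormedSpace ℂ Y] (h : BVMeasure U Y) : Integrable h.g h.μ := by
  have := h.finite
  refine Integrable.mono' (integrable_const (1:ℝ)) h.g_meas ?_
  filter_upwards [h.g_norm] with r hr
  exact hr.le

namespace SystemNode

variable {U X Xm1 Y : Type*}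
  [NormedAddCommGroup U] [NormedSpace ℂ U] [FiniteDimensional ℂ U]
  [NormedAddCommGroup X] [NormedSpace ℂ X] [CompleteSpace X]
  [NormedAddCommGroup Xm1] [NormedSpace ℂ Xm1] [CompleteSpace Xm1]
  [NormedAddCommGroup Y] [NormedSpace ℂ Y] [FiniteDimensional ℂ Y]
  (sys : SystemNode U X Xm1 Y)

lemma R_state {β : ℂ} (hβ : sys.S.growthBound < β.re) {u : ℝ → U} {xs : ℝ → Xm1}
    (hm : sys.IsMildState 0 u xs) {σ : ℝ} (hσ : 0 ≤ σ) :
    sys.R β (xs σ) = ∫ r in Icc 0 σ, sys.Fop ((sys.R β).comp sys.B) r (u (σ - r)) := by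
  obtain ⟨hi, hx⟩ := hm.2.2 σ hσ
  rw [hx, map_zero, map_zero, zero_add, ← ContinuousLinearMap.intervalIntegral_comp_comm _ hi,
    integral_Icc_eq_integral_Ioc, ← intervalIntegral.integral_of_le hσ]
  have := intervalIntegral.integral_comp_sub_left (a := 0) (b := σ)
    (fun s => sys.Fop ((sys.R β).comp sys.B) (σ - s) (u s)) σ
  simp only [sub_sub_cancel, sub_self, sub_zero] at this
  rw [this]
  apply intervalIntegral.integral_congr
  intro s hs
  rw [uIcc_of_le hσ] at hs
  have h0 : 0 ≤ σ - s := by linarith [hs.2]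
  simp only [Fop, max_eq_left h0, ContinuousLinearMap.comp_apply]
  exact sys.R_comm hβ h0 _

lemma J_K {β : ℂ} (hβ : sys.S.growthBound < β.re) {u : ℝ → U} {xs : ℝ → Xm1}
    (hm : sys.IsMildState 0 u xs) {t : ℝ} (ht : 0 ≤ t) (hu : IntegrableOn u (Icc 0 t))
    {K : X} (hK : sys.ι K = ∫ s in (0:ℝ)..t, (t - s) • xs s) :
    sys.Jop β K = ∫ s in (0:ℝ)..t, sys.I2 ((sys.R β).comp sys.B) (t - s) (u s) := by
  set b := (sys.R β).comp sys.B with hb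
  have hc : ContinuousOn (fun s => (t - s) • xs s) (uIcc 0 t) := by
    rw [uIcc_of_le ht]
    exact (continuous_const.sub continuous_id).continuousOn.smul (hm.2.1.mono Icc_subset_Ici_self)
  have e1 : sys.Jop β K = ∫ σ in (0:ℝ)..t, (t - σ) • ∫ r in Icc 0 σ, sys.Fop b r (u (σ - r)) := by
    rw [Jop, ContinuousLinearMap.comp_apply, hK,
      ← ContinuousLinearMap.intervalIntegral_comp_comm _ hc.intervalIntegrable]
    apply intervalIntegral.integral_congr
    intro σ hs
    rw [uIcc_of_le ht] at hs
    simp only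
    rw [← Complex.coe_smul, map_smul, Complex.coe_smul, sys.R_state hβ hm hs.1]
  have hF := sys.Fop_continuous b
  have key := aux_conv_interval (volume.restrict (Icc 0 t)) (by
      rw [Measure.restrict_apply measurableSet_Iio]
      have : Iio 0 ∩ Icc 0 t = ∅ := by
        ext x; simp only [mem_inter_iff, mem_Iio, mem_Icc, mem_empty_iff_false, iff_false]
        intro hx; linarith [hx.1, hx.2.1]
      rw [this, measure_empty]) (sys.Fop b)
    (hF.continuousOn.integrableOn_compact isCompact_Icc) u t ht hu
  rw [e1]
  refine Eq.trans ?_ (key.trans ?_)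
  · apply intervalIntegral.integral_congr
    intro σ hs
    rw [uIcc_of_le ht] at hs
    simp only
    rw [Measure.restrict_restrict measurableSet_Icc,
      inter_eq_left.2 (Icc_subset_Icc le_rfl hs.2)]
  · apply intervalIntegral.integral_congr
    intro s hs
    rw [uIcc_of_le ht] at hs
    simp only
    rw [sys.I2_eq b (by linarith [hs.2] : 0 ≤ t - s) (by linarith [hs.1])]

lemma CD_eq {u : ℝ → U} {xs : ℝ → Xm1} (h : BVMeasure U Y) (hG : LaplaceMatches sys h)
    (hm : sys.IsMildState 0 u xs) {t : ℝ} (ht : 0 ≤ t)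
    {K : X} (hK : sys.ι K = ∫ s in (0:ℝ)..t, (t - s) • xs s)
    {L : U} (hL : L = ∫ s in (0:ℝ)..t, (t - s) • u s) :
    sys.CD K L = ∫ σ in (0:ℝ)..t, (t - σ) • h.conv u σ := by
  have hu : IntegrableOn u (Icc 0 t) :=
    hm.1.integrableOn_compact_subset Icc_subset_Ici_self isCompact_Icc
  have hβ : sys.S.growthBound < sys.betaPt.re := by simp [betaPt]
  have := h.finite
  unfold CD
  set β := sys.betaPt
  set b := (sys.R β).comp sys.B with hb
  obtain ⟨Cb, hCb⟩ := sys.exists_Cbeta hβ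
  obtain ⟨w, hw, hF⟩ := sys.Fop_expB b
  have hP : Continuous (sys.Pop β b) := (sys.Pop_expB hw β b hF).1
  have iP := ker_intervalIntegrable (sys.Pop β b) hP u t ht hu
  have iI := ker_intervalIntegrable (sys.I2 b) (sys.I2_continuous b) u t ht hu
  have hi : IntervalIntegrable (fun s => (t - s) • u s) volume 0 t := by
    have := ker_int_smul (ContinuousLinearMap.id ℂ U) u t ht hu
    refine this.congr (fun s _ => ?_)
    change ((t - s : ℝ) : ℂ) • u s = (t - s) • u s
    rw [Complex.coe_smul]
  have hLX : sys.Jop β (b L) = ∫ s in (0:ℝ)..t, (((t - s : ℝ) : ℂ) • sys.JJ β b) (u s) := by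
    rw [hL, ← ContinuousLinearMap.comp_apply,
      ← ContinuousLinearMap.intervalIntegral_comp_comm _ hi]
    apply intervalIntegral.integral_congr
    intro s _
    simp only
    rw [← Complex.coe_smul, map_smul]
    rfl
  have hLY : sys.G β L = ∫ s in (0:ℝ)..t, (((t - s : ℝ) : ℂ) • sys.G β) (u s) := by
    rw [hL, ← ContinuousLinearMap.intervalIntegral_comp_comm _ hi]
    apply intervalIntegral.integral_congr
    intro s _
    simp only
    rw [← Complex.coe_smul, map_smul]
    rfl
  set Z := ∫ s in (0:ℝ)..t, sys.Pop β b (t - s) (u s) with hZ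
  have hJJ : sys.Jop β (sys.Jop β Z) = sys.Jop β K - sys.Jop β (b L) := by
    rw [hLX, sys.J_K hβ hm ht hu hK, ← intervalIntegral.integral_sub iI (ker_int_smul _ u t ht hu), hZ,
      ← ContinuousLinearMap.comp_apply, ← ContinuousLinearMap.intervalIntegral_comp_comm _ iP]
    apply intervalIntegral.integral_congr
    intro s hs
    rw [uIcc_of_le ht] at hs
    simp only
    have := congrArg (fun f => f (u s)) (sys.Pop_id hβ b (by linarith [hs.2] : 0 ≤ t - s))
    simpa [JJ_apply] using this
  have hJZ : sys.Jop β Z = K - b L := by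
    rw [← sub_eq_zero]
    apply sys.Jop_inj hβ
    rw [map_sub, hJJ, map_sub, sub_self]
  have e1 : sys.R β (sys.B L) = b L := rfl
  rw [e1, ← hJZ, ← hCb, hLY, hZ, ← ContinuousLinearMap.intervalIntegral_comp_comm _ iP]
  simp only [← ContinuousLinearMap.comp_apply]
  rw [← intervalIntegral.integral_add
      (ker_intervalIntegrable (fun τ => Cb.comp (sys.Pop β b τ)) (by fun_prop) u t ht hu) (ker_int_smul _ u t ht hu)]
  unfold BVMeasure.conv
  rw [aux_conv_interval h.μ h.supported h.g h.g_integrable u t ht hu]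
  apply intervalIntegral.integral_congr
  intro s hs
  rw [uIcc_of_le ht] at hs
  simp only
  rw [← sys.kernel_eq hβ Cb hCb h hG h.g_integrable (by linarith [hs.2] : 0 ≤ t - s)]
  rfl

lemma output_eq (h : BVMeasure U Y) (hG : LaplaceMatches sys h)
    (u : ℝ → U) (xs : ℝ → Xm1) (y : ℝ → Y)
    (hsol : sys.IsGeneralizedSolution 0 u xs y) :
    ∀ᵐ t ∂(volume.restrict (Ioi (0:ℝ))), y t = h.conv u t := by
  have := h.finite
  obtain ⟨hm, hy, K, L, hK, hL, -, hφ⟩ := hsol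
  have : CompleteSpace Y := FiniteDimensional.complete ℂ Y
  have hv : ∀ t, IntegrableOn (h.conv u) (Icc 0 t) := fun t =>
    aux_conv_integrableOn h.μ h.supported h.g h.g_integrable u t
      (hm.1.integrableOn_compact_subset Icc_subset_Ici_self isCompact_Icc)
  have hvl : LocallyIntegrableOn (h.conv u) (Ioi 0) := by
    rw [locallyIntegrableOn_iff (isOpen_Ioi.isLocallyClosed)]
    intro k hk hkc
    obtain ⟨T0, hT0⟩ := hkc.isBounded.subset_closedBall 0
    refine (hv T0).mono_set fun x hx => ⟨(hk hx).le, ?_⟩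
    have := hT0 hx
    rw [Metric.mem_closedBall, dist_zero_right, Real.norm_eq_abs] at this
    exact (le_abs_self x).trans this
  have hyl : LocallyIntegrableOn y (Ioi 0) := hy.mono_set Ioi_subset_Ici_self
  have key := IsOpen.ae_eq_zero_of_integral_contDiff_smul_eq_zero (μ := volume) isOpen_Ioi
    (hyl.sub hvl) (by
      intro φ hφs hc hs
      have hz : ∀ x, x ∉ Ioi (0:ℝ) → φ x = 0 := fun x hx => by
        by_contra hne
        exact hx (hs (subset_tsupport _ hne))
      have e0 : ∫ x, φ x • (y - h.conv u) x = ∫ x in Ioi 0, φ x • (y - h.conv u) x := by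
        rw [setIntegral_eq_integral_of_forall_compl_eq_zero]
        intro x hx
        rw [hz x hx, zero_smul]
      rw [e0]
      have hint : ∀ f : ℝ → Y, LocallyIntegrableOn f (Ioi 0) →
          IntegrableOn (fun x => φ x • f x) (Ioi 0) := by
        intro f hf
        have h1 : IntegrableOn f (tsupport φ) := hf.integrableOn_compact_subset hs hc
        have h2 : IntegrableOn (fun x => φ x • f x) (tsupport φ) :=
          h1.continuousOn_smul hφs.continuous.continuousOn hc
        have h3 : Integrable (fun x => φ x • f x) :=
          (integrableOn_iff_integrable_of_support_subset (s := tsupport φ) (fun x hx => by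
            by_contra hne
            exact hx (by simp [image_eq_zero_of_notMem_tsupport hne]))).1 h2
        exact h3.integrableOn
      simp only [Pi.sub_apply, smul_sub]
      rw [integral_sub (hint y hyl) (hint _ hvl), sub_eq_zero, ← hφ φ hφs hc hs,
        ← aux_test (h.conv u) hv φ hφs hc hs]
      apply setIntegral_congr_fun measurableSet_Ioi
      intro t ht
      simp only
      rw [sys.CD_eq h hG hm (le_of_lt ht) (hK t (le_of_lt ht)) (hL t (le_of_lt ht))])
  rw [ae_restrict_iff' measurableSet_Ioi]
  filter_upwards [key] with t ht h0
  exact sub_eq_zero.1 (ht h0)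

end SystemNode

lemma BVMeasure.conv_bound {U Y : Type*} [NormedAddCommGroup U] [NormedSpace ℂ U]
    [NormedAddCommGroup Y] [NormedSpace ℂ Y] (h : BVMeasure U Y) (u : ℝ → U) (T : ℝ) (hT : 0 < T)
    (M : ℝ) (hM : ∀ᵐ s ∂(volume.restrict (Ioc (0:ℝ) T)), ‖u s‖ ≤ M) :
    ∀ᵐ t ∂(volume.restrict (Ioc (0:ℝ) T)), ‖h.conv u t‖ ≤ h.var * M := by
  have := h.finite
  have hM0 : 0 ≤ M := by
    by_contra hneg
    have : ∀ᵐ s ∂(volume.restrict (Ioc (0:ℝ) T)), False := by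
      filter_upwards [hM] with s hs
      exact hneg ((norm_nonneg _).trans hs)
    rw [Filter.eventually_false_iff_eq_bot, ae_eq_bot, Measure.restrict_eq_zero] at this
    simp [hT.not_ge] at this
  rw [ae_restrict_iff' measurableSet_Ioc] at hM
  have hM' : ∀ᵐ s : ℝ, s ∈ Icc 0 T → ‖u s‖ ≤ M := by
    have h0 : ∀ᵐ s : ℝ, s ≠ 0 := by
      simp [ae_iff]
    filter_upwards [hM, h0] with s hs hs0 hsI
    exact hs ⟨lt_of_le_of_ne hsI.1 (Ne.symm hs0), hsI.2⟩
  have q := (measurePreserving_prod_neg_add h.μ (volume : Measure ℝ)).quasiMeasurePreserving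
  have h1 : ∀ᵐ z ∂(h.μ.prod (volume : Measure ℝ)), z.2 ∈ Icc 0 T → ‖u z.2‖ ≤ M :=
    Measure.quasiMeasurePreserving_snd.ae hM'
  have h2 := q.ae h1
  have h3 := (Measure.measurePreserving_swap (μ := (volume : Measure ℝ)) (ν := h.μ)).quasiMeasurePreserving.ae h2
  have h4 := Measure.ae_ae_of_ae_prod h3
  rw [ae_restrict_iff' measurableSet_Ioc]
  filter_upwards [h4] with t ht htT
  have hb : ∀ᵐ r ∂(h.μ.restrict (Icc 0 t)), ‖h.g r (u (t - r))‖ ≤ M := by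
    rw [ae_restrict_iff' measurableSet_Icc]
    filter_upwards [ht, h.g_norm] with r hr hg hrI
    have hr' : ‖u (t - r)‖ ≤ M := by
      have := hr
      simp only [Prod.swap, neg_add_eq_sub] at this
      exact this ⟨by linarith [hrI.2], by linarith [hrI.1, htT.2]⟩
    calc _ ≤ ‖h.g r‖ * ‖u (t - r)‖ := ContinuousLinearMap.le_opNorm _ _
      _ ≤ M := by rw [hg, one_mul]; exact hr'
  have := norm_integral_le_of_norm_le_const hb
  refine this.trans ?_
  rw [mul_comm]
  gcongr
  unfold BVMeasure.var
  rw [Measure.real, Measure.restrict_apply_univ]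
  exact ENNReal.toReal_mono (measure_ne_top _ _) (measure_mono (subset_univ _))

end AuxFinal

/-- Proposition 3.10: let the system node be `C^∞`-BIBO stable with
finite-dimensional input and output spaces and let `h` be the measure of bounded total
variation with `ĥ = G` on `ℂ_{ω(T)}`.  Then every generalised solution in the
distributional sense with zero initial state and locally essentially bounded input
satisfies `y = h ∗ u` (a.e.), is locally essentially bounded, and
`‖y‖_{L^∞([0,T])} ≤ ‖h‖_M ‖u‖_{L^∞([0,T])}` for all `T > 0`. -/
theorem distributional_solutions_convolution_bound
    {U X Xm1 Y : Type*}
    [NormedAddCommGroup U] [NormedSpace ℂ U] [FiniteDimensional ℂ U]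
    [NormedAddCommGroup X] [NormedSpace ℂ X] [CompleteSpace X]
    [NormedAddCommGroup Xm1] [NormedSpace ℂ Xm1] [CompleteSpace Xm1]
    [NormedAddCommGroup Y] [NormedSpace ℂ Y] [FiniteDimensional ℂ Y]
    (sys : SystemNode U X Xm1 Y)
    (hbibo : sys.CInfBIBOStable)
    (h : BVMeasure U Y) (hG : LaplaceMatches sys h)
    (u : ℝ → U) (xs : ℝ → Xm1) (y : ℝ → Y)
    (hsol : sys.IsGeneralizedSolution 0 u xs y)
    (hu : ∀ t : ℝ, 0 < t → ∃ M : ℝ,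
      ∀ᵐ s ∂(MeasureTheory.volume.restrict (Set.Ioc (0:ℝ) t)), ‖u s‖ ≤ M) :
    (∀ᵐ t ∂(MeasureTheory.volume.restrict (Set.Ioi (0:ℝ))), y t = h.conv u t) ∧
    ∀ T : ℝ, 0 < T → ∀ M : ℝ,
      (∀ᵐ s ∂(MeasureTheory.volume.restrict (Set.Ioc (0:ℝ) T)), ‖u s‖ ≤ M) →
      (∀ᵐ s ∂(MeasureTheory.volume.restrict (Set.Ioc (0:ℝ) T)), ‖y s‖ ≤ h.var * M) := by
  have hy := sys.output_eq h hG u xs y hsol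
  refine ⟨hy, fun T hT M hM => ?_⟩
  have h1 := h.conv_bound u T hT M hM
  have h2 := ae_restrict_of_ae_restrict_of_subset (show Ioc 0 T ⊆ Ioi 0 from fun x hx => hx.1) hy
  filter_upwards [h1, h2] with s hs1 hs2
  rw [hs2]
  exact hs1
end

section
/- Let Σ(A,B,C,G) be a C^∞-BIBO stable system node with A the generator of an analytic strongly continuous semigroup T and with finite-dimensional input and output spaces U and Y. Then the function t ↦ C T(t) B (which is well-defined for t > 0 by analyticity) belongs to L^1([0,∞), L(U,Y)). -/
open MeasureTheory Set
open scoped ENNReal NNReal Topology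

namespace BiboAux

open Filter

variable {U X Xm1 Y : Type*}
  [NormedAddCommGroup U] [NormedSpace ℂ U]
  [NormedAddCommGroup X] [NormedSpace ℂ X]
  [NormedAddCommGroup Xm1] [NormedSpace ℂ Xm1]
  [NormedAddCommGroup Y] [NormedSpace ℂ Y]

lemma contDiffOn_T [CompleteSpace X] (S : C0Semigroup X) (h : S.IsAnalytic) :
    ContDiffOn ℝ (⊤ : ℕ∞) S.T (Ioi 0) := by
  obtain ⟨θ, ⟨hθ0, hθ1⟩, F, hF, hFT, -⟩ := h
  set V := interior {z : ℂ | z ≠ 0 ∧ |Complex.arg z| < θ} with hV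
  have hVo : IsOpen V := isOpen_interior
  have hmem : ∀ t : ℝ, 0 < t → (t : ℂ) ∈ V := by
    intro t ht
    rw [hV, mem_interior_iff_mem_nhds]
    have h0 : (t : ℂ) ≠ 0 := by exact_mod_cast ht.ne'
    have h1 : ContinuousAt (fun z : ℂ => |Complex.arg z|) (t : ℂ) := by
      refine (Complex.continuousAt_arg ?_).abs
      exact Complex.ofReal_mem_slitPlane.2 ht
    have h2 : |Complex.arg (t : ℂ)| < θ := by
      rw [Complex.arg_ofReal_of_nonneg ht.le]; simpa using hθ0
    filter_upwards [isOpen_ne.mem_nhds h0, h1.eventually (gt_mem_nhds h2)] with z hz hz'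
    exact ⟨hz, hz'⟩
  have hFV : DifferentiableOn ℂ F V := hF.mono interior_subset
  have hc : ContDiffOn ℂ (⊤ : ℕ∞) F V := hFV.contDiffOn hVo
  have hc' : ContDiffOn ℝ (⊤ : ℕ∞) F V := hc.restrict_scalars ℝ
  have : ContDiffOn ℝ (⊤ : ℕ∞) (fun t : ℝ => F (t : ℂ)) (Ioi 0) :=
    hc'.comp (Complex.ofRealCLM.contDiff.contDiffOn) (fun t ht => hmem t ht)
  exact this.congr (fun t ht => (hFT t ht).symm)

lemma T_bound [CompleteSpace X] (S : C0Semigroup X) (b : ℝ) :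
    ∃ M, ∀ t ∈ Icc 0 b, ‖S.T t‖ ≤ M := by
  have := banach_steinhaus (g := fun t : Icc (0:ℝ) b => S.T t) (fun x => by
    obtain ⟨C, hC⟩ := (isCompact_Icc (a := (0:ℝ)) (b := b)).exists_bound_of_continuousOn
      ((S.strongly_continuous x).mono Icc_subset_Ici_self)
    exact ⟨C, fun i => hC i i.2⟩)
  obtain ⟨C, hC⟩ := this
  exact ⟨C, fun t ht => hC ⟨t, ht⟩⟩

noncomputable def ker (S : C0Semigroup X) : ℝ → X →L[ℂ] X := (Ioi (0:ℝ)).indicator S.T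

lemma ker_locInt [CompleteSpace X] (S : C0Semigroup X) (h : ContinuousOn S.T (Ioi 0)) :
    LocallyIntegrable (ker S) volume := by
  rw [locallyIntegrable_iff]
  intro k hk
  obtain ⟨b, hb⟩ := hk.isBounded.subset_closedBall 0
  obtain ⟨M, hM⟩ := T_bound S b
  have hmeas : AEStronglyMeasurable (ker S) volume := by
    unfold ker
    rw [aestronglyMeasurable_indicator_iff measurableSet_Ioi]
    exact h.aestronglyMeasurable measurableSet_Ioi
  refine IntegrableOn.of_bound hk.measure_lt_top hmeas.restrict (max M 0) ?_
  filter_upwards [ae_restrict_mem hk.measurableSet] with t ht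
  unfold ker
  by_cases h0 : 0 < t
  · rw [indicator_of_mem (by exact h0)]
    have := hb ht
    rw [Metric.mem_closedBall, dist_zero_right, Real.norm_eq_abs] at this
    exact (hM t ⟨h0.le, (le_abs_self _).trans this⟩).trans (le_max_left _ _)
  · rw [indicator_of_notMem (by exact h0)]; simp

noncomputable def pair (X : Type*) [NormedAddCommGroup X] [NormedSpace ℂ X] :
    (X →L[ℂ] X) →L[ℝ] X →L[ℝ] X := ContinuousLinearMap.restrictScalarsL ℂ X X ℝ ℝ

@[simp] lemma pair_apply (K : X →L[ℂ] X) (x : X) : pair X K x = K x := rfl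

open scoped Convolution

/-- convolution -/
noncomputable def cv (S : C0Semigroup X) (f : ℝ → X) : ℝ → X := (ker S ⋆[pair X, volume] f)

lemma cv_eq (S : C0Semigroup X) (g : ℝ → X) (hg : ∀ r ≤ 0, g r = 0) (t : ℝ) (ht : 0 ≤ t) :
    cv S g t = ∫ s in (0:ℝ)..t, S.T s (g (t - s)) := by
  unfold cv
  rw [convolution_def, intervalIntegral.integral_of_le ht, ← integral_indicator measurableSet_Ioc]
  congr 1
  ext s
  rw [pair_apply]
  unfold ker
  by_cases h0 : 0 < s
  · rw [indicator_of_mem (by exact h0)]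
    by_cases h1 : s ≤ t
    · rw [indicator_of_mem (by exact ⟨h0, h1⟩)]
    · rw [indicator_of_notMem (by exact fun h => h1 h.2), hg _ (by linarith), _root_.map_zero]
  · rw [indicator_of_notMem (by exact h0), indicator_of_notMem (by exact fun h => h0 h.1)]; simp

lemma cv_int [CompleteSpace X] (S : C0Semigroup X) (h : ContinuousOn S.T (Ioi 0))
    (g : ℝ → X) (hc : Continuous g) (hs : HasCompactSupport g) (t a b : ℝ) (ha : 0 ≤ a) (hb : 0 ≤ b) :
    IntervalIntegrable (fun s => S.T s (g (t - s))) volume a b := by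
  have h1 : Integrable (fun s => ker S s (g (t - s))) volume :=
    hs.convolutionExists_right (pair X) (ker_locInt S h) hc t
  have h2 := h1.intervalIntegrable (a := a) (b := b)
  refine h2.congr ?_
  intro s hs
  have : 0 < s := lt_of_le_of_lt (le_min ha hb) hs.1
  simp only [ker]
  rw [indicator_of_mem (by exact this)]

/-- Am1 T = ι T' -/
lemma Am1_T (sys : SystemNode U X Xm1 Y) {D : X →L[ℂ] X} {t : ℝ} (ht : 0 < t)
    (h : HasDerivAt sys.S.T D t) (x : X) : sys.Am1 (sys.S.T t x) = sys.ι (D x) := by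
  have h1 : HasDerivAt (fun τ => sys.ι (sys.S.T τ x)) (sys.ι (D x)) t := by
    have h2 : HasDerivAt (fun τ => sys.S.T τ x) (D x) t := by
      have := (((ContinuousLinearMap.apply ℂ X x).restrictScalars ℝ).hasFDerivAt).comp_hasDerivAt t h
      exact this
    exact ((sys.ι.restrictScalars ℝ).hasFDerivAt).comp_hasDerivAt t h2
  have h3 := (sys.generator x t ht.le).hasDerivAt (Ici_mem_nhds ht)
  exact h3.unique h1

lemma Am1_T' (sys : SystemNode U X Xm1 Y) {T1 : ℝ → X →L[ℂ] X} {D : X →L[ℂ] X} {t : ℝ} (ht : 0 < t)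
    (h : ∀ t, 0 < t → HasDerivAt sys.S.T (T1 t) t)
    (h' : HasDerivAt T1 D t) (x : X) : sys.Am1 (T1 t x) = sys.ι (D x) := by
  have h0 : HasDerivAt (fun τ => sys.S.T τ x) (T1 t x) t :=
    (((ContinuousLinearMap.apply ℂ X x).restrictScalars ℝ).hasFDerivAt).comp_hasDerivAt t (h t ht)
  have h0' : HasDerivAt (fun τ => T1 τ x) (D x) t :=
    (((ContinuousLinearMap.apply ℂ X x).restrictScalars ℝ).hasFDerivAt).comp_hasDerivAt t h'
  have h1 : HasDerivAt (fun τ => sys.Am1 (sys.S.T τ x)) (sys.Am1 (T1 t x)) t :=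
    ((sys.Am1.restrictScalars ℝ).hasFDerivAt).comp_hasDerivAt t h0
  have h2 : HasDerivAt (fun τ => sys.ι (T1 τ x)) (sys.ι (D x)) t :=
    ((sys.ι.restrictScalars ℝ).hasFDerivAt).comp_hasDerivAt t h0'
  refine h1.unique (h2.congr_of_eventuallyEq ?_)
  filter_upwards [Ioi_mem_nhds ht] with τ hτ
  exact Am1_T sys hτ (h τ hτ) x

lemma Sm1_Am1 (sys : SystemNode U X Xm1 Y) {t : ℝ} (ht : 0 ≤ t) (x : X) :
    sys.Sm1.T t (sys.Am1 x) = sys.Am1 (sys.S.T t x) := by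
  have h0 := sys.generator x 0 le_rfl
  rw [sys.S.map_zero] at h0
  have h1 : HasDerivWithinAt (fun τ => sys.Sm1.T t (sys.ι (sys.S.T τ x)))
      (sys.Sm1.T t (sys.Am1 x)) (Ici 0) 0 :=
    (((sys.Sm1.T t).restrictScalars ℝ).hasFDerivAt).comp_hasDerivWithinAt 0 h0
  have h2 : HasDerivWithinAt (fun τ : ℝ => sys.ι (sys.S.T τ (sys.S.T t x)))
      (sys.Am1 (sys.S.T t x)) (Ici 0) 0 := by
    have := sys.generator (sys.S.T t x) 0 le_rfl
    rwa [sys.S.map_zero] at this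
  have h3 : HasDerivWithinAt (fun τ : ℝ => sys.ι (sys.S.T τ (sys.S.T t x)))
      (sys.Sm1.T t (sys.Am1 x)) (Ici 0) 0 := by
    have key : ∀ τ : ℝ, 0 ≤ τ → sys.ι (sys.S.T τ (sys.S.T t x)) =
        sys.Sm1.T t (sys.ι (sys.S.T τ x)) := by
      intro τ hτ
      rw [sys.semigroup_compat t ht]
      have e1 := sys.S.map_add τ t hτ ht
      have e2 := sys.S.map_add t τ ht hτ
      rw [add_comm] at e1
      rw [e1] at e2
      congr 1
      exact DFunLike.congr_fun e2 x
    exact h1.congr (fun τ hτ => key τ hτ) (key 0 le_rfl)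
  exact (uniqueDiffOn_Ici (0:ℝ) 0 (by simp)).eq_deriv _ h3 h2

lemma cv_gen [CompleteSpace X] [CompleteSpace Xm1] (sys : SystemNode U X Xm1 Y)
    {T1 : ℝ → X →L[ℂ] X}
    (h : ∀ t, 0 < t → HasDerivAt sys.S.T (T1 t) t)
    (f : ℝ → X) (hf : ContDiff ℝ 1 f) (hs : HasCompactSupport f) (hs0 : tsupport f ⊆ Ioi 0)
    (t : ℝ) (ht : 0 ≤ t) :
    sys.Am1 (cv sys.S f t) + sys.ι (f t) = sys.ι (cv sys.S (deriv f) t) := by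
  have hcont : ContinuousOn sys.S.T (Ioi 0) := fun t ht =>
    (h t ht).continuousAt.continuousWithinAt
  have hdc : Continuous (deriv f) := hf.continuous_deriv le_rfl
  have z0 : ∀ r ≤ 0, f r = 0 := fun r hr => image_eq_zero_of_notMem_tsupport
    (fun hh => absurd (hs0 hh) (not_lt.2 hr))
  have z1 : ∀ r ≤ 0, deriv f r = 0 := fun r hr => by
    by_contra hne
    exact absurd (hs0 (support_deriv_subset hne)) (not_lt.2 hr)
  rw [cv_eq sys.S f z0 t ht, cv_eq sys.S _ z1 t ht]
  have i0 := cv_int sys.S hcont f hf.continuous hs t 0 t le_rfl ht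
  have i1 := cv_int sys.S hcont _ hdc hs.deriv t 0 t le_rfl ht
  rw [← sys.Am1.intervalIntegral_comp_comm i0, ← sys.ι.intervalIntegral_comp_comm i1]
  have j0 : IntervalIntegrable (fun s => sys.Am1 (sys.S.T s (f (t - s)))) volume 0 t :=
    ⟨sys.Am1.integrable_comp i0.1, sys.Am1.integrable_comp i0.2⟩
  have j1 : IntervalIntegrable (fun s => sys.ι (sys.S.T s (deriv f (t - s)))) volume 0 t :=
    ⟨sys.ι.integrable_comp i1.1, sys.ι.integrable_comp i1.2⟩
  have hd : ∀ s ∈ Ioo 0 t, HasDerivAt (fun s => sys.ι (sys.S.T s (f (t - s))))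
      (sys.Am1 (sys.S.T s (f (t - s))) - sys.ι (sys.S.T s (deriv f (t - s)))) s := by
    intro s hs
    have e1 : HasDerivAt (fun s => f (t - s)) (-deriv f (t - s)) s :=
      ((hf.differentiable one_ne_zero (t - s)).hasDerivAt).comp_const_sub t s
    have e2 := (((pair X).hasFDerivAt).comp_hasDerivAt s (h s hs.1)).clm_apply e1
    have e3 := ((sys.ι.restrictScalars ℝ).hasFDerivAt).comp_hasDerivAt s e2
    refine e3.congr_deriv ?_
    rw [Am1_T sys hs.1 (h s hs.1)]
    simp [sub_eq_add_neg]
  have hc : ContinuousOn (fun s => sys.ι (sys.S.T s (f (t - s)))) (Icc 0 t) := by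
    refine sys.ι.continuous.comp_continuousOn ?_
    intro s hs
    obtain ⟨M, hM⟩ := T_bound sys.S t
    have t1 : Tendsto (fun r => sys.S.T r (f (t - s))) (𝓝[Icc 0 t] s) (𝓝 (sys.S.T s (f (t - s)))) :=
      (sys.S.strongly_continuous (f (t - s)) s hs.1).mono Icc_subset_Ici_self
    have t2 : Tendsto (fun r => sys.S.T r (f (t - r) - f (t - s))) (𝓝[Icc 0 t] s) (𝓝 0) := by
      refine squeeze_zero_norm' (a := fun r => M * ‖f (t - r) - f (t - s)‖) ?_ ?_
      · filter_upwards [self_mem_nhdsWithin] with r hr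
        exact (sys.S.T r).le_of_opNorm_le (hM r hr) _
      · have : Continuous (fun r => M * ‖f (t - r) - f (t - s)‖) := by
          have := hf.continuous
          fun_prop
        have := (this.tendsto s).mono_left (nhdsWithin_le_nhds (s := Icc 0 t))
        simpa using this
    have := t2.add t1
    simp only [map_sub, sub_add_cancel, zero_add] at this
    exact this
  have := intervalIntegral.integral_eq_sub_of_hasDerivAt_of_le ht hc hd (j0.sub j1)
  rw [intervalIntegral.integral_sub j0 j1] at this
  rw [sub_self, sub_zero, z0 0 le_rfl, sys.S.map_zero] at this
  simp only [_root_.map_zero, ContinuousLinearMap.id_apply, zero_sub] at this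
  rw [sub_eq_iff_eq_add] at this
  rw [this]; abel

lemma cv_eq' (S : C0Semigroup X) (g : ℝ → X) (a b t : ℝ) (ha : 0 < a) (hab : a ≤ b)
    (hg : ∀ s ∉ Ioc a b, g (t - s) = 0) :
    cv S g t = ∫ s in a..b, S.T s (g (t - s)) := by
  unfold cv
  rw [convolution_def, intervalIntegral.integral_of_le hab, ← integral_indicator measurableSet_Ioc]
  congr 1
  ext s
  rw [pair_apply]
  by_cases h1 : s ∈ Ioc a b
  · rw [indicator_of_mem h1]
    unfold ker
    rw [indicator_of_mem (by exact ha.trans h1.1)]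
  · rw [indicator_of_notMem h1, hg _ h1, _root_.map_zero]

lemma by_parts [CompleteSpace X] (K K' : ℝ → X →L[ℂ] X) (β : ℂ) (v : ℝ → X) (hv : ContDiff ℝ 1 v)
    (hK : ∀ s, 0 < s → HasDerivAt K (K' s) s) (hK' : ContinuousOn K' (Ioi 0))
    (a b t : ℝ) (ha : 0 < a) (hab : a ≤ b) (va : v (t - a) = 0) (vb : v (t - b) = 0) :
    ∫ s in a..b, K s (β • v (t - s) - deriv v (t - s)) =
      ∫ s in a..b, (β • K s - K' s) (v (t - s)) := by
  have hsub : uIcc a b ⊆ Ioi 0 := by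
    rw [uIcc_of_le hab]; exact fun s hs => ha.trans_le hs.1
  have hKc : ContinuousOn K (uIcc a b) := fun s hs =>
    (hK s (hsub hs)).continuousAt.continuousWithinAt
  have hK'c : ContinuousOn K' (uIcc a b) := hK'.mono hsub
  have hv0 : Continuous (fun s => v (t - s)) := hv.continuous.comp (by fun_prop)
  have hv1 : Continuous (fun s => deriv v (t - s)) := (hv.continuous_deriv le_rfl).comp (by fun_prop)
  have i1 : IntervalIntegrable (fun s => K s (β • v (t - s) - deriv v (t - s))) volume a b :=
    (hKc.clm_apply ((hv0.const_smul β).sub hv1).continuousOn).intervalIntegrable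
  have i2 : IntervalIntegrable (fun s => (β • K s - K' s) (v (t - s))) volume a b :=
    (((hKc.const_smul β).sub hK'c).clm_apply hv0.continuousOn).intervalIntegrable
  rw [← sub_eq_zero, ← intervalIntegral.integral_sub i1 i2]
  have hd : ∀ s ∈ uIcc a b, HasDerivAt (fun s => K s (v (t - s)))
      (K s (β • v (t - s) - deriv v (t - s)) - (β • K s - K' s) (v (t - s))) s := by
    intro s hs
    have e1 : HasDerivAt (fun s => v (t - s)) (-deriv v (t - s)) s :=
      ((hv.differentiable one_ne_zero (t - s)).hasDerivAt).comp_const_sub t s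
    have e2 := (((pair X).hasFDerivAt).comp_hasDerivAt s (hK s (hsub hs))).clm_apply e1
    refine e2.congr_deriv ?_
    simp
    abel
  rw [intervalIntegral.integral_eq_sub_of_hasDerivAt hd (i1.sub i2), va, vb]
  simp

lemma beta_re (sys : SystemNode U X Xm1 Y) : sys.S.growthBound < sys.betaPt.re := by
  simp [SystemNode.betaPt]

lemma Am1_R (sys : SystemNode U X Xm1 Y) (w : Xm1) :
    sys.Am1 (sys.R sys.betaPt w) = sys.betaPt • sys.ι (sys.R sys.betaPt w) - w := by
  have := sys.R_right sys.betaPt (beta_re sys) w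
  rw [sub_eq_iff_eq_add] at this
  rw [this]; abel

lemma Am1_Rι (sys : SystemNode U X Xm1 Y) (x : X) :
    sys.Am1 (sys.R sys.betaPt (sys.ι x)) =
      sys.ι (sys.betaPt • sys.R sys.betaPt (sys.ι x) - x) := by
  rw [Am1_R]; simp

lemma exists_Ct (sys : SystemNode U X Xm1 Y) : ∃ Ct : X →L[ℂ] Y, ∀ x z : X,
    sys.Am1 x = sys.ι z → sys.Cop x = Ct (sys.betaPt • x - z) := by
  obtain ⟨M, hM⟩ := sys.Cop_bound
  let P : X →L[ℂ] X := (sys.R sys.betaPt).comp sys.ι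
  let Q : X →L[ℂ] X := sys.betaPt • P - ContinuousLinearMap.id ℂ X
  have hPQ : ∀ x, sys.Am1 (P x) = sys.ι (Q x) := fun x => by
    have := Am1_Rι sys x
    simpa [P, Q] using this
  let L : X →ₗ[ℂ] Y :=
    { toFun := fun x => sys.Cop (P x)
      map_add' := fun x y => by
        rw [_root_.map_add, sys.Cop_add _ _ ⟨_, hPQ x⟩ ⟨_, hPQ y⟩]
      map_smul' := fun a x => by
        rw [_root_.map_smul, sys.Cop_smul _ _ ⟨_, hPQ x⟩]; rfl }
  refine ⟨L.mkContinuous (|M| * (‖P‖ + ‖Q‖)) (fun x => ?_), fun x z hxz => ?_⟩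
  · have h1 := hM (P x) (Q x) (hPQ x)
    have h2 : ‖P x‖ + ‖Q x‖ ≤ (‖P‖ + ‖Q‖) * ‖x‖ := by
      rw [add_mul]; exact add_le_add (P.le_opNorm x) (Q.le_opNorm x)
    calc ‖L x‖ ≤ M * (‖P x‖ + ‖Q x‖) := h1
      _ ≤ |M| * (‖P x‖ + ‖Q x‖) := by gcongr; exact le_abs_self M
      _ ≤ |M| * ((‖P‖ + ‖Q‖) * ‖x‖) := by gcongr
      _ = _ := by ring
  · have h1 := sys.R_left sys.betaPt (beta_re sys) x
    have : P (sys.betaPt • x - z) = x := by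
      conv_rhs => rw [← h1]
      simp [P, hxz]
    change sys.Cop x = sys.Cop (P (sys.betaPt • x - z))
    rw [this]

/-- kernel -/
noncomputable def Fk (sys : SystemNode U X Xm1 Y) (Ct : X →L[ℂ] Y) (T1 T2 : ℝ → X →L[ℂ] X)
    (s : ℝ) : U →L[ℂ] Y :=
  Ct.comp ((sys.betaPt • (sys.betaPt • sys.S.T s - T1 s) - (sys.betaPt • T1 s - T2 s)).comp
    ((sys.R sys.betaPt).comp sys.B))

lemma main_bound [CompleteSpace X] [CompleteSpace Xm1] [CompleteSpace Y]
    (sys : SystemNode U X Xm1 Y) (Ct : X →L[ℂ] Y) (hCt : ∀ x z : X,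
    sys.Am1 x = sys.ι z → sys.Cop x = Ct (sys.betaPt • x - z)) (T1 T2 : ℝ → X →L[ℂ] X)
    (h1 : ∀ t, 0 < t → HasDerivAt sys.S.T (T1 t) t)
    (h2 : ∀ t, 0 < t → HasDerivAt T1 (T2 t) t) (h3 : ContinuousOn T2 (Ioi 0))
    (hbibo : sys.CInfBIBOStable) :
    ∃ c : ℝ, 0 < c ∧ ∀ (φ : ℝ → U) (a' a b b' M : ℝ), 0 < a' → a' < a → a ≤ b → b < b' →
      ContDiff ℝ (⊤ : ℕ∞) φ → (∀ s ∉ Icc a b, φ s = 0) → (∀ s, ‖φ s‖ ≤ M) →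
      ‖∫ s in a'..b', Fk sys Ct T1 T2 s (φ s)‖ ≤ c * M := by
  obtain ⟨c, hc, H⟩ := hbibo
  refine ⟨c, hc, ?_⟩
  intro φ a' a b b' M ha' haa hab hbb hφ hφ0 hφM
  set t := b' + 1 with ht
  set β := sys.betaPt with hβ
  have hT : ContinuousOn sys.S.T (Ioi 0) := fun t ht =>
    (h1 t ht).continuousAt.continuousWithinAt
  have hT1 : ContinuousOn T1 (Ioi 0) := fun t ht =>
    (h2 t ht).continuousAt.continuousWithinAt
  set u : ℝ → U := fun r => φ (t - r) with hu
  have hus : ContDiff ℝ (⊤ : ℕ∞) u := hφ.comp (contDiff_const.sub contDiff_id)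
  have hut : tsupport u ⊆ Icc (t - b) (t - a) := by
    refine closure_minimal ?_ isClosed_Icc
    intro r hr
    by_contra hn
    exact hr (hφ0 _ (fun hh => hn ⟨by linarith [hh.2], by linarith [hh.1]⟩))
  have huc : HasCompactSupport u := isCompact_Icc.of_isClosed_subset (isClosed_tsupport u) hut
  have hpos : Icc (t - b) (t - a) ⊆ Ioi (0:ℝ) := fun r hr => by
    have := hr.1
    simp only [mem_Ioi]; linarith
  have hdu : ContDiff ℝ (⊤ : ℕ∞) (deriv u) := (contDiff_infty_iff_deriv.1 hus).2
  let RB : U →L[ℝ] X := ((sys.R β).comp sys.B).restrictScalars ℝ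
  have hRB : ∀ x, RB x = sys.R β (sys.B x) := fun x => rfl
  set v : ℝ → X := fun r => RB (u r) with hv
  have hvs : ContDiff ℝ (⊤ : ℕ∞) v := RB.contDiff.comp hus
  have hvd : ∀ r, HasDerivAt v (RB (deriv u r)) r := fun r =>
    RB.hasFDerivAt.comp_hasDerivAt r ((hus.differentiable (by simp) r).hasDerivAt)
  have hvd' : ∀ r, deriv v r = RB (deriv u r) := fun r => (hvd r).deriv
  have hdv : ContDiff ℝ (⊤ : ℕ∞) (deriv v) := (contDiff_infty_iff_deriv.1 hvs).2
  set f : ℝ → X := fun r => β • v r - deriv v r with hf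
  have hfs : ContDiff ℝ (⊤ : ℕ∞) f := (hvs.const_smul β).sub hdv
  have hvt : tsupport v ⊆ tsupport u := closure_mono (fun r hr => by
    intro h0; exact hr (by simp [hv, h0]))
  have hfz : ∀ r ∉ Icc (t - b) (t - a), f r = 0 := by
    intro r hr
    have e1 : r ∉ tsupport v := fun h => hr (hut (hvt h))
    have e2 : deriv v r = 0 := by
      by_contra h
      exact e1 (support_deriv_subset h)
    simp [hf, e2, image_eq_zero_of_notMem_tsupport e1]
  have hft : tsupport f ⊆ Icc (t - b) (t - a) := by
    refine closure_minimal ?_ isClosed_Icc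
    intro r hr
    by_contra hn
    exact hr (hfz r hn)
  have hfc : HasCompactSupport f := isCompact_Icc.of_isClosed_subset (isClosed_tsupport f) hft
  have hf1 : ContDiff ℝ 1 f := hfs.of_le (by exact_mod_cast le_top)
  have hv1 : ContDiff ℝ 1 v := hvs.of_le (by exact_mod_cast le_top)
  have hfd : Continuous (deriv f) := hf1.continuous_deriv le_rfl
  have hgen := cv_gen sys h1 f hf1 hfc (hft.trans hpos)
  set w := cv sys.S f with hw
  set w' := cv sys.S (deriv f) with hw'
  have hL := ker_locInt sys.S hT
  have hwd : ∀ r, HasDerivAt w (w' r) r := fun r =>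
    hfc.hasDerivAt_convolution_right (pair X) hL hf1 r
  have hwc' : Continuous w' := hfc.deriv.continuous_convolution_right (pair X) hL hfd
  have hwc : Continuous w := hfc.continuous_convolution_right (pair X) hL hf1.continuous
  -- key identity
  have key : ∀ r, 0 ≤ r → sys.Am1 (w r) = sys.ι (w' r - f r) := by
    intro r hr
    rw [_root_.map_sub, ← hgen r hr]; abel
  have hcd : ∀ r, 0 ≤ r → sys.CD (w r + v r) (u r) =
      Ct (β • w r - (w' r - f r)) + sys.G β (u r) := by
    intro r hr
    unfold SystemNode.CD
    rw [← hβ, ← hRB, show w r + v r - RB (u r) = w r by simp [hv]]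
    rw [hCt _ _ (key r hr)]
  have hsol : sys.IsClassicalSolution u (fun r => w r + v r)
      (fun r => sys.CD (w r + v r) (u r)) := by
    refine ⟨hus.continuous.continuousOn, ?_, ⟨fun r => w' r + deriv v r, ?_, ?_, ?_⟩, fun r _ => rfl⟩
    · have : Continuous (fun r => Ct (β • w r - (w' r - f r)) + sys.G β (u r)) :=
        (Ct.continuous.comp ((hwc.const_smul β).sub (hwc'.sub hf1.continuous))).add
          ((sys.G β).continuous.comp hus.continuous)
      exact this.continuousOn.congr (fun r hr => hcd r hr)
    · exact (hwc'.add hdv.continuous).continuousOn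
    · intro r _
      exact ((hwd r).add ((hvd r).congr_deriv (hvd' r).symm)).hasDerivWithinAt
    · intro r hr
      rw [_root_.map_add, key r hr]
      simp only [hv, hRB]
      rw [Am1_R, ← hβ, ← hRB]
      simp only [hf, hv, _root_.map_sub, _root_.map_add, _root_.map_smul]
      abel
  have hw0 : w 0 = 0 := by
    rw [hw, cv_eq sys.S f (fun r hr => hfz r (fun h => absurd (hpos h) (not_lt.2 hr))) 0 le_rfl]
    simp
  have huz : ∀ r ∉ Icc (t - b) (t - a), u r = 0 := fun r hr =>
    image_eq_zero_of_notMem_tsupport (fun h => hr (hut h))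
  have hx0 : w 0 + v 0 = 0 := by
    rw [hw0]; simp only [hv]
    rw [huz 0 (fun h => absurd (hpos h) (by simp))]; simp
  have ht0 : 0 ≤ t := by linarith
  have hy := H u _ _ hsol hx0 hus huc (hut.trans hpos) M (fun s => hφM _) t ht0
  have htn : t ∉ Icc (t - b) (t - a) := fun h => by linarith [h.2]
  rw [hcd t ht0, huz t htn, hfz t htn] at hy
  simp only [_root_.map_zero, add_zero, sub_zero] at hy
  convert hy using 2
  have hab' : a' ≤ b' := by linarith
  have hz : ∀ s ∉ Ioc a' b', (t - s) ∉ Icc (t - b) (t - a) := fun s hs h =>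
    hs ⟨by linarith [h.2], by linarith [h.1]⟩
  have hfdz : ∀ r ∉ Icc (t - b) (t - a), deriv f r = 0 := fun r hr => by
    by_contra h
    exact hr (hft (support_deriv_subset h))
  have hza : t - a' ∉ Icc (t - b) (t - a) := fun h => by linarith [h.2]
  have hzb : t - b' ∉ Icc (t - b) (t - a) := fun h => by linarith [h.1]
  have hvz : ∀ r ∉ Icc (t - b) (t - a), v r = 0 := fun r hr => by simp [hv, huz r hr]
  have i0 := cv_int sys.S hT f hf1.continuous hfc t a' b' ha'.le (by linarith)
  have i1 := cv_int sys.S hT _ hfd hfc.deriv t a' b' ha'.le (by linarith)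
  have i0' : IntervalIntegrable (fun s => β • sys.S.T s (f (t - s))) volume a' b' := i0.smul β
  have E0 : β • w t - w' t = ∫ s in a'..b', sys.S.T s (β • f (t - s) - deriv f (t - s)) := by
    rw [hw, hw', cv_eq' sys.S f a' b' t ha' hab' (fun s hs => hfz _ (hz s hs)),
      cv_eq' sys.S _ a' b' t ha' hab' (fun s hs => hfdz _ (hz s hs)),
      ← intervalIntegral.integral_smul, ← intervalIntegral.integral_sub i0' i1]
    congr 1
    ext s
    simp
  have hT1' : ∀ s, 0 < s → HasDerivAt (fun s => β • sys.S.T s - T1 s) (β • T1 s - T2 s) s :=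
    fun s hs => ((h1 s hs).const_smul β).sub (h2 s hs)
  rw [by_parts sys.S.T T1 β f hf1 h1 hT1 a' b' t ha' hab' (hfz _ hza) (hfz _ hzb)] at E0
  simp only [hf] at E0
  rw [by_parts (fun s => β • sys.S.T s - T1 s) (fun s => β • T1 s - T2 s) β v hv1 hT1'
    ((hT1.const_smul β).sub h3) a' b' t ha' hab' (hvz _ hza) (hvz _ hzb)] at E0
  rw [E0, ← Ct.intervalIntegral_comp_comm]
  · refine intervalIntegral.integral_congr (fun s _ => ?_)
    simp [Fk, hv, hu, hRB, hβ]
  · refine ContinuousOn.intervalIntegrable ?_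
    have hsub : uIcc a' b' ⊆ Ioi 0 := by
      rw [uIcc_of_le hab']; exact fun s hs => ha'.trans_le hs.1
    refine ContinuousOn.clm_apply (𝕜 := ℂ) ?_ (hv1.continuous.comp (by fun_prop)).continuousOn
    exact ((((hT.const_smul β).sub hT1).const_smul β).sub ((hT1.const_smul β).sub h3)).mono hsub

lemma scalar_integrable (f : ℝ → ℂ) (hf : ContDiffOn ℝ (⊤ : ℕ∞) f (Ioi 0)) (c : ℝ)
    (H : ∀ (φ : ℝ → ℂ) (a' a b b' : ℝ), 0 < a' → a' < a → a ≤ b → b < b' →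
      ContDiff ℝ (⊤ : ℕ∞) φ → (∀ s ∉ Icc a b, φ s = 0) → (∀ s, ‖φ s‖ ≤ 1) →
      ‖∫ s in a'..b', f s * φ s‖ ≤ c) : IntegrableOn f (Ioi 0) := by
  have hfc : ContinuousOn f (Ioi 0) := hf.continuousOn
  have bound : ∀ p q : ℝ, 0 < p → p < q → ∫ s in Icc p q, ‖f s‖ ≤ c := by
    intro p q hp hpq
    let χ : ContDiffBump ((p + q) / 2) := ⟨(q - p) / 2, (q - p) / 2 + p / 2, by linarith, by linarith⟩
    have hχ1 : ∀ s ∈ Icc p q, χ s = 1 := fun s hs => χ.one_of_mem_closedBall (by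
      rw [Metric.mem_closedBall, Real.dist_eq, abs_le]
      constructor <;> simp only [χ] <;> linarith [hs.1, hs.2])
    have hχ0 : ∀ s ∉ Icc (p / 2) (q + p / 2), χ s = 0 := fun s hs => by
      refine χ.zero_of_le_dist ?_
      rw [Real.dist_eq]
      by_contra hlt
      rw [not_le, abs_lt] at hlt
      simp only [χ] at hlt
      exact hs ⟨by linarith [hlt.1], by linarith [hlt.2]⟩
    have ha' : 0 < p / 4 := by linarith
    have hab' : p / 4 ≤ q + p := by linarith
    have hsub : uIcc (p / 4) (q + p) ⊆ Ioi 0 := by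
      rw [uIcc_of_le hab']; exact fun s hs => ha'.trans_le hs.1
    have key : ∀ δ : ℝ, 0 < δ → ∫ s in (p/4)..(q+p), χ s * ‖f s‖ ≤ c + δ * (q + p - p / 4) := by
      intro δ hδ
      let g : ℝ → ℝ := fun s => √(‖f s‖ ^ 2 + δ ^ 2)
      have hgpos : ∀ s, 0 < g s := fun s => Real.sqrt_pos.2 (by positivity)
      have hgge : ∀ s, ‖f s‖ ≤ g s := fun s => Real.le_sqrt_of_sq_le (by nlinarith)
      have hgle : ∀ s, g s ≤ ‖f s‖ + δ := fun s => by
        rw [Real.sqrt_le_iff]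
        constructor
        · positivity
        · nlinarith [norm_nonneg (f s)]
      let φ : ℝ → ℂ := fun s => ((χ s / g s : ℝ) : ℂ) * (starRingEnd ℂ) (f s)
      have hφ0 : ∀ s ∉ Icc (p / 2) (q + p / 2), φ s = 0 := fun s hs => by simp [φ, hχ0 s hs]
      have hgs : ContDiffOn ℝ (⊤ : ℕ∞) g (Ioi 0) := by
        refine ContDiffOn.sqrt ((hf.norm_sq ℝ).add contDiffOn_const) (fun s _ => by positivity)
      have hφsOn : ContDiffOn ℝ (⊤ : ℕ∞) φ (Ioi 0) := by
        refine ContDiffOn.mul ?_ ?_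
        · exact Complex.ofRealCLM.contDiff.comp_contDiffOn
            ((χ.contDiff.contDiffOn).div hgs (fun s _ => (hgpos s).ne'))
        · exact Complex.conjCLE.contDiff.comp_contDiffOn hf
      have hφs : ContDiff ℝ (⊤ : ℕ∞) φ := by
        rw [contDiff_iff_contDiffAt]
        intro s
        by_cases hs : 0 < s
        · exact hφsOn.contDiffAt (Ioi_mem_nhds hs)
        · have : φ =ᶠ[𝓝 s] fun _ => 0 := by
            filter_upwards [Iio_mem_nhds (show s < p / 2 by linarith)] with r hr
            exact hφ0 r (fun h => absurd h.1 (not_le.2 hr))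
          exact contDiffAt_const.congr_of_eventuallyEq this
      have hφ1 : ∀ s, ‖φ s‖ ≤ 1 := fun s => by
        simp only [φ, norm_mul, Complex.norm_real, RCLike.norm_conj, Real.norm_eq_abs, abs_div,
          abs_of_pos (hgpos s), abs_of_nonneg (χ.nonneg' s)]
        rw [div_mul_eq_mul_div, div_le_one (hgpos s)]
        calc χ s * ‖f s‖ ≤ 1 * ‖f s‖ := by gcongr; exact χ.le_one
          _ ≤ g s := by rw [one_mul]; exact hgge s
      have h := H φ (p / 4) (p / 2) (q + p / 2) (q + p) ha' (by linarith) (by linarith) (by linarith)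
        hφs hφ0 hφ1
      have e1 : ∀ s, f s * φ s = ((χ s * (‖f s‖ ^ 2 / g s) : ℝ) : ℂ) := fun s => by
        simp only [φ]
        rw [mul_left_comm, Complex.mul_conj, Complex.normSq_eq_norm_sq]
        push_cast; ring
      simp only [e1] at h
      rw [intervalIntegral.integral_ofReal, Complex.norm_real] at h
      have h' := (le_abs_self _).trans h
      have hnc : ContinuousOn (fun s => ‖f s‖) (uIcc (p / 4) (q + p)) := (hfc.mono hsub).norm
      have hχc : ContinuousOn (fun s => χ s) (uIcc (p / 4) (q + p)) := χ.continuous.continuousOn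
      have hgc : ContinuousOn g (uIcc (p / 4) (q + p)) := hgs.continuousOn.mono hsub
      have j1 : IntervalIntegrable (fun s => χ s * ‖f s‖) volume (p / 4) (q + p) :=
        (hχc.mul hnc).intervalIntegrable
      have j2 : IntervalIntegrable (fun s => χ s * (‖f s‖ ^ 2 / g s)) volume (p / 4) (q + p) :=
        (hχc.mul ((hnc.pow 2).div hgc (fun s _ => (hgpos s).ne'))).intervalIntegrable
      have hmono := intervalIntegral.integral_mono_on hab' j1
        (j2.add (intervalIntegrable_const (c := δ))) (fun s _ => by
          have : ‖f s‖ ≤ ‖f s‖ ^ 2 / g s + δ := by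
            rw [← sub_le_iff_le_add, le_div_iff₀ (hgpos s)]
            nlinarith [hgle s, hgge s, norm_nonneg (f s), hgpos s]
          have c0 := χ.nonneg' s
          have c1 : χ s ≤ 1 := χ.le_one
          nlinarith)
      rw [intervalIntegral.integral_add j2 intervalIntegrable_const,
        intervalIntegral.integral_const, smul_eq_mul] at hmono
      linarith
    have hA : ∫ s in (p/4)..(q+p), χ s * ‖f s‖ ≤ c := by
      refine le_of_forall_pos_le_add (fun ε hε => ?_)
      have hl : 0 < q + p - p / 4 := by linarith
      have := key (ε / (q + p - p / 4)) (by positivity)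
      rwa [div_mul_cancel₀ _ hl.ne'] at this
    refine le_trans ?_ hA
    rw [intervalIntegral.integral_of_le hab']
    have hint : IntegrableOn (fun s => χ s * ‖f s‖) (Ioc (p / 4) (q + p)) := by
      have : IntervalIntegrable (fun s => χ s * ‖f s‖) volume (p / 4) (q + p) :=
        (χ.continuous.continuousOn.mul (hfc.mono hsub).norm).intervalIntegrable
      exact this.1
    calc ∫ s in Icc p q, ‖f s‖ = ∫ s in Icc p q, χ s * ‖f s‖ :=
          setIntegral_congr_fun measurableSet_Icc (fun s hs => by simp [hχ1 s hs])
      _ ≤ _ := setIntegral_mono_set hint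
          (Eventually.of_forall (fun s => mul_nonneg (χ.nonneg' s) (norm_nonneg _)))
          (LE.le.eventuallyLE (fun s hs => ⟨by linarith [hs.1], by linarith [hs.2]⟩))
  have hcov : AECover (volume.restrict (Ioi (0:ℝ))) atTop
      (fun n : ℕ => Icc (1 / ((n:ℝ) + 1)) ((n:ℝ) + 2)) :=
    (aecover_Ioi_of_Ici tendsto_one_div_add_atTop_nhds_zero_nat).inter
      ((aecover_Iic (tendsto_atTop_add_const_right _ _ tendsto_natCast_atTop_atTop)))
  have hss : ∀ n : ℕ, Icc (1 / ((n:ℝ) + 1)) ((n:ℝ) + 2) ⊆ Ioi 0 := fun n s hs =>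
    lt_of_lt_of_le (by positivity) hs.1
  refine hcov.integrable_of_integral_norm_bounded c (fun n => ?_) (Eventually.of_forall fun n => ?_)
  · rw [IntegrableOn, Measure.restrict_restrict measurableSet_Icc,
      inter_eq_self_of_subset_left (hss n)]
    exact (hfc.mono (hss n)).integrableOn_Icc
  · rw [Measure.restrict_restrict measurableSet_Icc, inter_eq_self_of_subset_left (hss n)]
    refine bound _ _ (by positivity) ?_
    have : 1 / ((n:ℝ) + 1) ≤ 1 := by
      rw [div_le_one (by positivity)]; linarith [n.cast_nonneg (α := ℝ)]
    linarith [n.cast_nonneg (α := ℝ)]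

lemma integrable_smul_const' {E : Type*} [NormedAddCommGroup E] [NormedSpace ℂ E]
    {n m : ℕ} (f : Fin n → Fin m → ℝ → ℂ) (e : Fin n → Fin m → E) (μ : Measure ℝ)
    (h : ∀ i j, Integrable (f i j) μ) :
    Integrable (fun s => ∑ i, ∑ j, f i j s • e i j) μ :=
  integrable_finsetSum _ (fun i _ => integrable_finsetSum _ (fun j _ => (h i j).smul_const _))

lemma rep [FiniteDimensional ℂ U] [FiniteDimensional ℂ Y] (L : U →L[ℂ] Y) :
    L = ∑ i, ∑ j, (LinearMap.toContinuousLinearMap ((Module.finBasis ℂ Y).coord j)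
      (L (Module.finBasis ℂ U i))) •
      (LinearMap.toContinuousLinearMap ((Module.finBasis ℂ U).coord i)).smulRight
        (Module.finBasis ℂ Y j) := by
  ext u
  simp only [_root_.sum_apply, _root_.smul_apply,
    ContinuousLinearMap.smulRight_apply]
  conv_lhs => rw [← (Module.finBasis ℂ U).sum_repr u, map_sum]
  refine Finset.sum_congr rfl (fun i _ => ?_)
  rw [_root_.map_smul]
  conv_lhs => rw [← (Module.finBasis ℂ Y).sum_repr (L (Module.finBasis ℂ U i)), Finset.smul_sum]
  refine Finset.sum_congr rfl (fun j _ => ?_)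
  rw [smul_comm]
  rfl

lemma integrable_of_scalar [FiniteDimensional ℂ U] [FiniteDimensional ℂ Y] (F : ℝ → U →L[ℂ] Y)
    (h : ∀ i (ℓ : Y →L[ℂ] ℂ), IntegrableOn (fun s => ℓ (F s (Module.finBasis ℂ U i))) (Ioi 0)) :
    IntegrableOn F (Ioi 0) := by
  have := integrable_smul_const' (fun i j s => LinearMap.toContinuousLinearMap
      ((Module.finBasis ℂ Y).coord j) (F s (Module.finBasis ℂ U i)))
    (fun i j => (LinearMap.toContinuousLinearMap ((Module.finBasis ℂ U).coord i)).smulRight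
        (Module.finBasis ℂ Y j)) (volume.restrict (Ioi (0:ℝ))) (fun i j => h i _)
  exact this.congr (Eventually.of_forall fun s => (rep (F s)).symm)

end BiboAux

/-- Proposition 4.4: for a `C^∞`-BIBO stable system node whose
generator generates an analytic semigroup and whose input and output spaces are
finite-dimensional, the (well-defined) function `t ↦ C T(t) B` belongs to
`L¹([0,∞), L(U,Y))`.  Well-definedness is expressed by the witness `F`:
for `t > 0` one has `T_{-1}(t) B u ∈ D(A)` and `F t u = C (T_{-1}(t) B u)`. -/
theorem cInfBIBO_analytic_CTB_integrable
    {U X Xm1 Y : Type*}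
    [NormedAddCommGroup U] [NormedSpace ℂ U] [FiniteDimensional ℂ U]
    [NormedAddCommGroup X] [NormedSpace ℂ X] [CompleteSpace X]
    [NormedAddCommGroup Xm1] [NormedSpace ℂ Xm1] [CompleteSpace Xm1]
    [NormedAddCommGroup Y] [NormedSpace ℂ Y] [FiniteDimensional ℂ Y]
    (sys : SystemNode U X Xm1 Y)
    (hana : sys.S.IsAnalytic)
    (hbibo : sys.CInfBIBOStable) :
    ∃ F : ℝ → U →L[ℂ] Y,
      (∀ t : ℝ, 0 < t → ∀ u : U, ∃ x z : X,
        sys.ι x = sys.Sm1.T t (sys.B u) ∧ sys.Am1 x = sys.ι z ∧ F t u = sys.Cop x) ∧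
      MeasureTheory.IntegrableOn F (Set.Ioi 0) := by
  obtain ⟨Ct, hCt⟩ := BiboAux.exists_Ct sys
  have hT := BiboAux.contDiffOn_T sys.S hana
  have hT1 : ContDiffOn ℝ (⊤ : ℕ∞) (deriv sys.S.T) (Ioi 0) :=
    hT.deriv_of_isOpen isOpen_Ioi (by simp)
  have hT2 : ContDiffOn ℝ (⊤ : ℕ∞) (deriv (deriv sys.S.T)) (Ioi 0) :=
    hT1.deriv_of_isOpen isOpen_Ioi (by simp)
  have h1 : ∀ t, 0 < t → HasDerivAt sys.S.T (deriv sys.S.T t) t := fun t ht =>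
    ((hT.contDiffAt (Ioi_mem_nhds ht)).differentiableAt (by simp)).hasDerivAt
  have h2 : ∀ t, 0 < t → HasDerivAt (deriv sys.S.T) (deriv (deriv sys.S.T) t) t := fun t ht =>
    ((hT1.contDiffAt (Ioi_mem_nhds ht)).differentiableAt (by simp)).hasDerivAt
  haveI : CompleteSpace Y := FiniteDimensional.complete ℂ Y
  obtain ⟨c, hc, H⟩ := BiboAux.main_bound sys Ct hCt _ _ h1 h2 hT2.continuousOn hbibo
  set F : ℝ → U →L[ℂ] Y := BiboAux.Fk sys Ct (deriv sys.S.T) (deriv (deriv sys.S.T)) with hF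
  refine ⟨F, ?_, ?_⟩
  · intro t ht u
    set β := sys.betaPt with hβ
    set r := sys.R β (sys.B u) with hr
    have a1 := BiboAux.Am1_T sys ht (h1 t ht) r
    have a2 := BiboAux.Am1_T' sys ht h1 (h2 t ht) r
    have hA : sys.Am1 (β • sys.S.T t r - deriv sys.S.T t r) =
        sys.ι (β • deriv sys.S.T t r - deriv (deriv sys.S.T) t r) := by
      simp only [map_sub, map_smul, a1, a2]
    refine ⟨β • sys.S.T t r - deriv sys.S.T t r,
      β • deriv sys.S.T t r - deriv (deriv sys.S.T) t r, ?_, hA, ?_⟩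
    · have hB := sys.R_right β (BiboAux.beta_re sys) (sys.B u)
      rw [← hB, ← hr]
      simp only [map_sub, map_smul]
      rw [BiboAux.Sm1_Am1 sys ht.le, a1, sys.semigroup_compat t ht.le]
    · rw [hCt _ _ hA]
      rfl
  · have hFs : ContDiffOn ℝ (⊤ : ℕ∞) F (Ioi 0) := by
      have hK : ContDiffOn ℝ (⊤ : ℕ∞) (fun s => sys.betaPt • (sys.betaPt • sys.S.T s -
          deriv sys.S.T s) - (sys.betaPt • deriv sys.S.T s - deriv (deriv sys.S.T) s)) (Ioi 0) :=
        (((hT.const_smul _).sub hT1).const_smul _).sub ((hT1.const_smul _).sub hT2)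
      let Λ1 : (X →L[ℂ] X) →L[ℂ] (U →L[ℂ] X) :=
        (ContinuousLinearMap.compL ℂ U X X).flip ((sys.R sys.betaPt).comp sys.B)
      let Λ2 : (U →L[ℂ] X) →L[ℂ] (U →L[ℂ] Y) := ContinuousLinearMap.compL ℂ U X Y Ct
      exact ((Λ2.comp Λ1).restrictScalars ℝ).contDiff.comp_contDiffOn hK
    refine BiboAux.integrable_of_scalar F (fun i ℓ => ?_)
    refine BiboAux.scalar_integrable _ ?_ (‖ℓ‖ * (c * ‖Module.finBasis ℂ U i‖)) ?_
    · let Λ : (U →L[ℂ] Y) →L[ℂ] ℂ := ℓ.comp (ContinuousLinearMap.apply ℂ Y (Module.finBasis ℂ U i))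
      exact (Λ.restrictScalars ℝ).contDiff.comp_contDiffOn hFs
    · intro φ a' a b b' ha' haa hab hbb hφ hφ0 hφ1
      have hh := H (fun s => φ s • Module.finBasis ℂ U i) a' a b b' ‖Module.finBasis ℂ U i‖ ha' haa hab hbb
        (hφ.smul contDiff_const) (fun s hs => by simp [hφ0 s hs]) (fun s => by
          rw [norm_smul]
          exact mul_le_of_le_one_left (norm_nonneg _) (hφ1 s))
      have hii : IntervalIntegrable (fun s => F s (φ s • Module.finBasis ℂ U i)) MeasureTheory.volume a' b' := by
        refine ContinuousOn.intervalIntegrable ?_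
        refine ContinuousOn.clm_apply (𝕜 := ℂ) (hFs.continuousOn.mono ?_)
          (hφ.continuous.smul continuous_const).continuousOn
        rw [uIcc_of_le (by linarith)]
        exact fun s hs => ha'.trans_le hs.1
      have e : ∫ s in a'..b', ℓ (F s (Module.finBasis ℂ U i)) * φ s =
          ℓ (∫ s in a'..b', F s (φ s • Module.finBasis ℂ U i)) := by
        rw [← ℓ.intervalIntegral_comp_comm hii]
        refine intervalIntegral.integral_congr (fun s _ => ?_)
        simp [mul_comm]
      rw [e]
      exact (ℓ.le_opNorm _).trans (by gcongr)
end
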